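/- arXiv:2510.08361 — 6 statements merged into one kernel-verified Lean document; each statement's English description precedes it below -/
import Mathlib

section
/- If G is a connected graph with exactly m edges and G is not a 4-cycle, then the 𝓒'-isolation number of G satisfies ι(G, 𝓒') ≤ (m+1)/6. -/
open SimpleGraph

/-- The closed neighbourhood `N[D]` of a set `D` of vertices of the graph `G`. -/
def closedNbhd {V : Type*} (G : SimpleGraph V) (D : Set V) : Set V :=
  D ∪ {v | ∃ u ∈ D, G.Adj u v}

/-- `G` contains a copy of `F`, i.e. a subgraph isomorphic to `F`. -/
def HasCopy {W V : Type*} (F : SimpleGraph W) (G : SimpleGraph V) : Prop :=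
  ∃ f : F →g G, Function.Injective f

/-- `D` is an isolating set of `G` with respect to the family of all cycles of length
at least `k` : the graph `G − N[D]` contains no copy of `C_n` for any `n ≥ k`.
For `k = 3` this is the family 𝓒 of all cycles; for `k = 4` it is the family 𝓒' of
non-triangle cycles. -/
def IsCycIsolatingGE {V : Type*} (k : ℕ) (G : SimpleGraph V) (D : Set V) : Prop :=
  ∀ n, k ≤ n → ¬ HasCopy (cycleGraph n) (G.induce (closedNbhd G D)ᶜ)

/-- The isolation number of `G` with respect to the family of cycles of length at least `k`:
the least cardinality of an isolating set. -/
noncomputable def iotaCycGE {V : Type*} (k : ℕ) (G : SimpleGraph V) : ℕ :=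
  sInf {r | ∃ D : Set V, D.ncard = r ∧ IsCycIsolatingGE k G D}

section IsolationOfLongCycles

open Finset

variable {V : Type*} [DecidableEq V] (G : SimpleGraph V) [DecidableRel G.Adj]

/-- The number of pairs in `X × Y` that are adjacent in `G`. -/
def crossCount (X Y : Finset V) : ℕ := ∑ x ∈ X, ∑ y ∈ Y, if G.Adj x y then 1 else 0

/-- The cycles of `G` with all vertices in `T` are triangles. -/
def LongCycleFree (T : Finset V) : Prop :=
  ∀ n, 4 ≤ n → ∀ f : Fin n → V, Function.Injective f → (∀ i, f i ∈ T) →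
    ¬ ∀ i j, (cycleGraph n).Adj i j → G.Adj (f i) (f j)

/-- `S` is nonempty and every proper cut of `G[S]` contains an edge. -/
def CutConnected (S : Finset V) : Prop :=
  S.Nonempty ∧ ∀ X ⊂ S, X.Nonempty → crossCount G X (S \ X) ≠ 0

/-- `G[S]` is a 4-cycle: it has four vertices and is 2-regular. -/
def IsSquare4 (S : Finset V) : Prop :=
  #S = 4 ∧ ∀ a ∈ S, crossCount G {a} S = 2

/-- The vertices of `S` outside the closed neighbourhood of `D`. -/
def undominated (S D : Finset V) : Finset V :=
  S.filter fun z => z ∉ D ∧ ∀ u ∈ D, ¬ G.Adj u z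

/-- `G[S]` has an isolating set `D` with `6 * #D ≤ e(G[S]) + 1`. -/
def SmallIsolation (S : Finset V) : Prop :=
  ∃ D : Finset V, 12 * #D ≤ crossCount G S S + 2 ∧ LongCycleFree G (undominated G S D)

variable {G}

omit [DecidableEq V] in
lemma crossCount_comm (X Y : Finset V) : crossCount G X Y = crossCount G Y X := by
  unfold crossCount
  rw [Finset.sum_comm]
  simp only [G.adj_comm]

omit [DecidableEq V] in
lemma crossCount_eq_card (X Y : Finset V) :
    crossCount G X Y = #((X ×ˢ Y).filter fun p => G.Adj p.1 p.2) := by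
  rw [Finset.card_filter, Finset.sum_product]
  rfl

omit [DecidableEq V] in
lemma crossCount_mono {X X' Y Y' : Finset V} (hX : X ⊆ X') (hY : Y ⊆ Y') :
    crossCount G X Y ≤ crossCount G X' Y' := by
  simp only [crossCount_eq_card]
  exact card_le_card (filter_subset_filter _ (product_subset_product hX hY))

omit [DecidableEq V] in
lemma crossCount_eq_zero_iff {X Y : Finset V} :
    crossCount G X Y = 0 ↔ ∀ x ∈ X, ∀ y ∈ Y, ¬ G.Adj x y := by
  simp [crossCount]

omit [DecidableEq V] in
lemma crossCount_pos {X Y : Finset V} {x y : V} (hx : x ∈ X) (hy : y ∈ Y) (h : G.Adj x y) :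
    0 < crossCount G X Y :=
  Nat.pos_of_ne_zero fun h0 => crossCount_eq_zero_iff.1 h0 x hx y hy h

omit [DecidableEq V] in
lemma exists_adj_of_crossCount_ne_zero {X Y : Finset V} (h : crossCount G X Y ≠ 0) :
    ∃ x ∈ X, ∃ y ∈ Y, G.Adj x y := by
  by_contra! h'
  exact h (crossCount_eq_zero_iff.2 h')

lemma crossCount_union_left {X Y : Finset V} (h : Disjoint X Y) (Z : Finset V) :
    crossCount G (X ∪ Y) Z = crossCount G X Z + crossCount G Y Z :=
  Finset.sum_union h

lemma crossCount_union_right {X Y : Finset V} (h : Disjoint X Y) (Z : Finset V) :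
    crossCount G Z (X ∪ Y) = crossCount G Z X + crossCount G Z Y := by
  simp only [crossCount_comm Z, crossCount_union_left h]

lemma crossCount_sdiff_left {X Y : Finset V} (h : Y ⊆ X) (Z : Finset V) :
    crossCount G (X \ Y) Z + crossCount G Y Z = crossCount G X Z :=
  Finset.sum_sdiff h

lemma crossCount_sdiff_right {X Y : Finset V} (h : Y ⊆ X) (Z : Finset V) :
    crossCount G Z (X \ Y) + crossCount G Z Y = crossCount G Z X := by
  simp only [crossCount_comm Z, crossCount_sdiff_left h]

lemma crossCount_union_right_le (X Y Z : Finset V) :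
    crossCount G Z (X ∪ Y) ≤ crossCount G Z X + crossCount G Z Y := by
  rw [← Finset.union_sdiff_self_eq_union, crossCount_union_right disjoint_sdiff]
  gcongr
  exact crossCount_mono subset_rfl sdiff_subset

lemma crossCount_union_self {X Y : Finset V} (h : Disjoint X Y) :
    crossCount G (X ∪ Y) (X ∪ Y) = crossCount G X X + crossCount G Y Y + 2 * crossCount G X Y := by
  rw [crossCount_union_left h, crossCount_union_right h, crossCount_union_right h,
    crossCount_comm Y X]
  ring

omit [DecidableEq V] in
lemma crossCount_singleton_self (x : V) : crossCount G {x} {x} = 0 := by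
  simp [crossCount]

omit [DecidableEq V] in
lemma crossCount_eq_sum (X Y : Finset V) :
    crossCount G X Y = ∑ x ∈ X, crossCount G {x} Y := by
  simp [crossCount]

omit [DecidableEq V] in
lemma crossCount_singleton_left (x : V) (Y : Finset V) :
    crossCount G {x} Y = #(Y.filter (G.Adj x)) := by
  simp [crossCount]

lemma even_crossCount_self (X : Finset V) : Even (crossCount G X X) := by
  induction X using Finset.induction_on with
  | empty => simp [crossCount]
  | insert a s ha ih =>
    rw [insert_eq, crossCount_union_self (by simpa using ha), crossCount_singleton_self]
    simpa using Even.add ih (even_two_mul _)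

omit [DecidableEq V] in
lemma two_le_crossCount {X Y : Finset V} {x y x' y' : V} (hx : x ∈ X) (hy : y ∈ Y)
    (hx' : x' ∈ X) (hy' : y' ∈ Y) (h : G.Adj x y) (h' : G.Adj x' y')
    (hne : (x, y) ≠ (x', y')) : 2 ≤ crossCount G X Y := by
  rw [crossCount_eq_card]
  exact Finset.one_lt_card.2 ⟨(x, y), by simp [*], (x', y'), by simp [*], hne⟩

omit [DecidableEq V] [DecidableRel G.Adj] in
lemma LongCycleFree.mono {S T : Finset V} (h : LongCycleFree G T) (hST : S ⊆ T) :
    LongCycleFree G S :=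
  fun n hn f hf hfS => h n hn f hf fun i => hST (hfS i)

omit [DecidableEq V] [DecidableRel G.Adj] in
lemma longCycleFree_of_card_le {T : Finset V} (h : #T ≤ 3) : LongCycleFree G T := by
  intro n hn f hf hfT _
  have := Finset.card_le_card_of_injOn (s := Finset.univ) f (fun i _ => hfT i) hf.injOn
  simp at this
  omega

/-- A cyclic sequence that takes both truth values switches from true to false. -/
lemma exists_cyclic_switch {n : ℕ} [NeZero n] (p : Fin n → Prop) {a b : Fin n}
    (ha : p a) (hb : ¬ p b) : ∃ i, p i ∧ ¬ p (i + 1) := by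
  by_contra! h
  have key : ∀ k : ℕ, p (a + Fin.ofNat n k) := by
    intro k
    induction k with
    | zero => simpa using ha
    | succ k ih =>
      have := h _ ih
      convert this using 1
      ext
      simp [Fin.val_add, add_assoc]
  apply hb
  have := key (b - a).val
  simpa using this

lemma LongCycleFree.union {X Y : Finset V} (hX : LongCycleFree G X) (hY : LongCycleFree G Y)
    (h : crossCount G X Y ≤ 1) : LongCycleFree G (X ∪ Y) := by
  intro n hn f hf hfXY hadj
  obtain ⟨n, rfl⟩ : ∃ k, n = k + 2 := ⟨n - 2, by omega⟩
  have hstep : ∀ i : Fin (n + 2), G.Adj (f i) (f (i + 1)) := fun i =>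
    hadj i (i + 1) (by simp [cycleGraph_adj])
  obtain ⟨a, ha⟩ : ∃ a, f a ∈ X := by
    by_contra! hno
    exact hY (n + 2) hn f hf (fun i => (mem_union.1 (hfXY i)).resolve_left (hno i)) hadj
  obtain ⟨b, hb⟩ : ∃ b, f b ∉ X := by
    by_contra! hno
    exact hX (n + 2) hn f hf hno hadj
  obtain ⟨i, hi, hi'⟩ := exists_cyclic_switch (fun i => f i ∈ X) ha hb
  obtain ⟨j, hj, hj'⟩ := exists_cyclic_switch (fun i => f i ∉ X) hb (by simpa using ha)
  have hmem : ∀ k, f k ∉ X → f k ∈ Y := fun k hk => (mem_union.1 (hfXY k)).resolve_left hk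
  have := two_le_crossCount hi (hmem _ hi') (not_not.1 hj') (hmem _ hj) (hstep i) (hstep j).symm
    (by
      intro heq
      rw [Prod.mk.injEq] at heq
      have h1 := hf heq.1
      have h2 := hf heq.2
      have h3 : (1 : Fin (n + 2)) + 1 = 0 := by
        have : j + (1 + 1) = j + 0 := by rw [← add_assoc, ← h1, h2, add_zero]
        exact add_left_cancel this
      have h4 := congrArg Fin.val h3
      rw [Fin.val_add] at h4
      simp only [Fin.val_one, Fin.val_zero] at h4
      rw [Nat.mod_eq_of_lt (by omega)] at h4
      omega)
  omega

lemma LongCycleFree.union_biUnion {B : Finset V} (hB : LongCycleFree G B)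
    (P : Finset (Finset V)) (X : Finset V → Finset V) (hX : ∀ H ∈ P, LongCycleFree G (X H))
    (hXB : ∀ H ∈ P, crossCount G (X H) B ≤ 1)
    (hXX : ∀ H ∈ P, ∀ H' ∈ P, H ≠ H' → crossCount G (X H) (X H') = 0) :
    LongCycleFree G (B ∪ P.biUnion X) := by
  induction P using Finset.induction_on with
  | empty => simpa using hB
  | insert H P hH ih =>
    rw [biUnion_insert, union_left_comm]
    refine (hX H (by simp)).union (ih (fun K hK => hX K (by simp [hK]))
      (fun K hK => hXB K (by simp [hK]))
      fun K hK K' hK' => hXX K (by simp [hK]) K' (by simp [hK'])) ?_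
    refine (crossCount_union_right_le _ _ _).trans ?_
    have h0 : crossCount G (X H) (P.biUnion X) = 0 := by
      rw [crossCount_eq_zero_iff]
      intro x hx y hy
      obtain ⟨K, hK, hyK⟩ := mem_biUnion.1 hy
      exact crossCount_eq_zero_iff.1 (hXX H (by simp) K (by simp [hK])
        (fun h => hH (h ▸ hK))) x hx y hyK
    rw [h0]
    exact hXB H (by simp)

variable (G) in
/-- `P` is the set of vertex sets of components of `G[T]`. -/
structure IsComponents (T : Finset V) (P : Finset (Finset V)) : Prop where
  conn : ∀ H ∈ P, CutConnected G H
  disj : ∀ H ∈ P, ∀ H' ∈ P, H ≠ H' → Disjoint H H'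
  sep : ∀ H ∈ P, ∀ H' ∈ P, H ≠ H' → crossCount G H H' = 0
  union : P.biUnion id = T

variable (G) in
lemma exists_isComponents (T : Finset V) : ∃ P, IsComponents G T P := by
  induction T using Finset.strongInduction with
  | H T ih =>
  rcases T.eq_empty_or_nonempty with rfl | hT
  · exact ⟨∅, by simp, by simp, by simp, by simp⟩
  by_cases hc : CutConnected G T
  · exact ⟨{T}, by simpa using hc, by simp, by simp, by simp⟩
  obtain ⟨X, hXT, hX, h0⟩ : ∃ X ⊂ T, X.Nonempty ∧ crossCount G X (T \ X) = 0 := by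
    by_contra! h
    exact hc ⟨hT, h⟩
  obtain ⟨P, hP⟩ := ih X hXT
  obtain ⟨Q, hQ⟩ := ih (T \ X) (sdiff_ssubset hXT.1 hX)
  have hPX : ∀ H ∈ P, H ⊆ X := fun H hH => hP.union ▸ subset_biUnion_of_mem id hH
  have hQX : ∀ H ∈ Q, H ⊆ T \ X := fun H hH => hQ.union ▸ subset_biUnion_of_mem id hH
  have hd : ∀ H ∈ P, ∀ K ∈ Q, Disjoint H K := fun H hH K hK =>
    disjoint_of_subset_left (hPX H hH) (disjoint_of_subset_right (hQX K hK) disjoint_sdiff)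
  have hs : ∀ H ∈ P, ∀ K ∈ Q, crossCount G H K = 0 := fun H hH K hK =>
    Nat.eq_zero_of_le_zero (h0 ▸ crossCount_mono (hPX H hH) (hQX K hK))
  refine ⟨P ∪ Q, ?_, ?_, ?_, ?_⟩
  · intro H hH
    exact (mem_union.1 hH).elim (hP.conn H) (hQ.conn H)
  · intro H hH K hK hne
    rcases mem_union.1 hH with hH | hH <;> rcases mem_union.1 hK with hK | hK
    exacts [hP.disj H hH K hK hne, hd H hH K hK, (hd K hK H hH).symm, hQ.disj H hH K hK hne]
  · intro H hH K hK hne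
    rcases mem_union.1 hH with hH | hH <;> rcases mem_union.1 hK with hK | hK
    exacts [hP.sep H hH K hK hne, hs H hH K hK, (crossCount_comm (G := G) H K).trans (hs K hK H hH),
      hQ.sep H hH K hK hne]
  · rw [union_biUnion, hP.union, hQ.union, union_sdiff_of_subset hXT.1]

namespace IsComponents

variable {T : Finset V} {P : Finset (Finset V)} (hP : IsComponents G T P)
include hP

lemma subset {H : Finset V} (hH : H ∈ P) : H ⊆ T :=
  hP.union ▸ subset_biUnion_of_mem id hH

lemma exists_mem {x : V} (hx : x ∈ T) : ∃ H ∈ P, x ∈ H := by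
  rw [← hP.union] at hx
  simpa using hx

lemma crossCount_left (Z : Finset V) : crossCount G T Z = ∑ H ∈ P, crossCount G H Z := by
  conv_lhs => rw [← hP.union]
  exact Finset.sum_biUnion fun H hH K hK hne => hP.disj H hH K hK hne

lemma crossCount_component {H : Finset V} (hH : H ∈ P) : crossCount G H T = crossCount G H H := by
  rw [crossCount_comm, hP.crossCount_left, Finset.sum_eq_single_of_mem H hH]
  exact fun K hK hne => hP.sep K hK H hH hne

lemma crossCount_self : crossCount G T T = ∑ H ∈ P, crossCount G H H := by
  rw [hP.crossCount_left]
  exact Finset.sum_congr rfl fun H hH => hP.crossCount_component hH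

lemma crossCount_sdiff {H : Finset V} (hH : H ∈ P) : crossCount G H (T \ H) = 0 := by
  have := crossCount_sdiff_right (G := G) (hP.subset hH) H
  rw [hP.crossCount_component hH] at this
  omega

end IsComponents

lemma undominated_subset (S D : Finset V) : undominated G S D ⊆ S := filter_subset _ _

lemma undominated_anti (S : Finset V) {D D' : Finset V} (h : D ⊆ D') :
    undominated G S D' ⊆ undominated G S D := by
  intro z hz
  simp only [undominated, mem_filter] at hz ⊢
  exact ⟨hz.1, fun hzD => hz.2.1 (h hzD), fun u hu => hz.2.2 u (h hu)⟩

lemma mem_undominated_of_mem {S T D : Finset V} {z : V} (hz : z ∈ undominated G S D)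
    (hzT : z ∈ T) : z ∈ undominated G T D := by
  simp only [undominated, mem_filter] at hz ⊢
  exact ⟨hzT, hz.2⟩

lemma notMem_undominated_of_adj {S D : Finset V} {u z : V} (hu : u ∈ D) (h : G.Adj u z) :
    z ∉ undominated G S D := by
  simp only [undominated, mem_filter]
  exact fun hz => hz.2.2 u hu h

lemma notMem_undominated_of_mem {S D : Finset V} {z : V} (hz : z ∈ D) :
    z ∉ undominated G S D := by
  simp only [undominated, mem_filter]
  exact fun h => h.2.1 hz

lemma LongCycleFree.undominated {S : Finset V} (h : LongCycleFree G S) (D : Finset V) :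
    LongCycleFree G (undominated G S D) :=
  h.mono (undominated_subset S D)

omit [DecidableEq V] in
lemma IsSquare4.crossCount_self {S : Finset V} (h : IsSquare4 G S) : crossCount G S S = 8 := by
  rw [crossCount_eq_sum, Finset.sum_congr rfl h.2]
  simp [h.1]

omit [DecidableRel G.Adj] in
lemma longCycleFree_of_subset_erase {S Z : Finset V} {a : V} (hS : #S ≤ 4) (ha : a ∈ S)
    (hZ : Z ⊆ S.erase a) : LongCycleFree G Z := by
  refine longCycleFree_of_card_le ?_
  have := card_le_card hZ
  rw [card_erase_of_mem ha] at this
  omega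

lemma undominated_subset_erase {S D : Finset V} {z : V} (hz : z ∉ undominated G S D) :
    undominated G S D ⊆ S.erase z :=
  fun _ hy => mem_erase.2 ⟨fun h => hz (h ▸ hy), undominated_subset S D hy⟩

lemma SmallIsolation.of_longCycleFree {S : Finset V} (h : LongCycleFree G S) :
    SmallIsolation G S :=
  ⟨∅, by simp, h.undominated ∅⟩

lemma CutConnected.of_crossCount_le_one {S X : Finset V} (hS : CutConnected G S) (hXS : X ⊆ S)
    (hX : X.Nonempty) (h : crossCount G X (S \ X) ≤ 1) : CutConnected G X := by
  refine ⟨hX, fun Z hZX hZ h0 => ?_⟩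
  have aux : ∀ Z ⊂ X, Z.Nonempty → crossCount G Z (X \ Z) = 0 →
      1 ≤ crossCount G Z (S \ X) := by
    intro Z hZX hZ h0
    have h1 := hS.2 Z (hZX.trans_subset hXS) hZ
    have h2 : crossCount G Z (S \ Z) ≤ crossCount G Z (X \ Z) + crossCount G Z (S \ X) := by
      refine le_trans (crossCount_mono subset_rfl ?_) (crossCount_union_right_le _ _ _)
      intro y hy
      simp only [mem_union, mem_sdiff] at hy ⊢
      tauto
    omega
  have h1 := aux Z hZX hZ h0
  have h2 := aux (X \ Z) (sdiff_ssubset hZX.1 hZ) (sdiff_nonempty.2 hZX.2)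
    (by rw [Finset.sdiff_sdiff_eq_self hZX.1, crossCount_comm, h0])
  have h3 := crossCount_sdiff_left (G := G) hZX.1 (S \ X)
  omega

lemma SmallIsolation.of_bridge_square {S X : Finset V} (hS : CutConnected G S) (hXS : X ⊆ S)
    (hX : IsSquare4 G X) (h : crossCount G X (S \ X) = 1)
    (ih : ∀ T ⊂ S, CutConnected G T → ¬ IsSquare4 G T → SmallIsolation G T) :
    SmallIsolation G S := by
  obtain ⟨x, hx, u, hu, hxu⟩ := exists_adj_of_crossCount_ne_zero
    (by omega : crossCount G X (S \ X) ≠ 0)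
  obtain ⟨P, hP⟩ := exists_isComponents G ((S \ X) \ {u})
  have hPS : ∀ H ∈ P, H ⊂ S := fun H hH => by
    refine ⟨(hP.subset hH).trans (sdiff_subset.trans sdiff_subset), fun hSH => ?_⟩
    have := hP.subset hH (hSH (hXS hx))
    simp [hx] at this
  have hHu : ∀ H ∈ P, 0 < crossCount G H {u} := by
    intro H hH
    obtain ⟨y, hy, z, hz, hyz⟩ := exists_adj_of_crossCount_ne_zero
      (hS.2 H (hPS H hH) (hP.conn H hH).1)
    have hy' := hP.subset hH hy
    simp only [mem_sdiff, mem_singleton] at hy' hz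
    by_cases hzu : z = u
    · exact crossCount_pos hy (by simpa using hzu) hyz
    by_cases hzX : z ∈ X
    · have := two_le_crossCount hx hu hzX (mem_sdiff.2 hy'.1) hxu hyz.symm
        (by simpa using fun _ => Ne.symm hy'.2)
      omega
    · exact absurd hyz (crossCount_eq_zero_iff.1 (hP.crossCount_sdiff hH) y hy z
        (by simp [*]))
  have hD : ∀ H ∈ P, ∃ D : Finset V, 12 * #D ≤ crossCount G H H + 2 * crossCount G H {u} ∧
      LongCycleFree G (undominated G H (insert u D)) := by
    intro H hH
    by_cases hsq : IsSquare4 G H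
    · obtain ⟨y, hy, z, hz, hyz⟩ := exists_adj_of_crossCount_ne_zero (hHu H hH).ne'
      rw [mem_singleton] at hz
      subst hz
      exact ⟨∅, by simp, longCycleFree_of_subset_erase hsq.1.le hy
        (undominated_subset_erase (notMem_undominated_of_adj (by simp) hyz.symm))⟩
    · obtain ⟨D, hD, hf⟩ := ih H (hPS H hH) (hP.conn H hH) hsq
      have := hHu H hH
      exact ⟨D, by omega, hf.mono (undominated_anti H (subset_insert u D))⟩
  choose! D hDc hDf using hD
  refine ⟨insert u (P.biUnion D), ?_, ?_⟩
  · have h1 : #(insert u (P.biUnion D)) ≤ ∑ H ∈ P, #(D H) + 1 :=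
      (card_insert_le _ _).trans (Nat.succ_le_succ card_biUnion_le)
    have h2 : ∑ H ∈ P, 12 * #(D H) ≤ ∑ H ∈ P, (crossCount G H H + 2 * crossCount G H {u}) :=
      Finset.sum_le_sum hDc
    rw [Finset.sum_add_distrib, ← Finset.mul_sum, ← Finset.mul_sum, ← hP.crossCount_self,
      ← hP.crossCount_left] at h2
    have h3 := crossCount_union_self (G := G) (X := X) (Y := S \ X) disjoint_sdiff
    have h4 := crossCount_union_self (G := G) (X := (S \ X) \ {u}) (Y := {u}) sdiff_disjoint
    rw [union_sdiff_of_subset hXS, hX.crossCount_self] at h3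
    rw [sdiff_union_of_subset (by simpa using hu), crossCount_singleton_self] at h4
    omega
  · have hBf : LongCycleFree G (undominated G X {u}) :=
      longCycleFree_of_subset_erase hX.1.le hx
        (undominated_subset_erase (notMem_undominated_of_adj (by simp) hxu.symm))
    refine (hBf.union_biUnion P (fun H => undominated G H (insert u (D H))) hDf ?_ ?_).mono ?_
    · intro H hH
      have h0 : crossCount G H X = 0 := by
        rw [crossCount_eq_zero_iff]
        intro y hy z hz hyz
        have hy' := hP.subset hH hy
        simp only [mem_sdiff, mem_singleton] at hy'
        have := two_le_crossCount hx hu hz (mem_sdiff.2 hy'.1) hxu hyz.symm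
          (by simpa using fun _ => Ne.symm hy'.2)
        omega
      have := crossCount_mono (G := G) (undominated_subset (G := G) H (insert u (D H)))
        (undominated_subset (G := G) X {u})
      omega
    · intro H hH K hK hne
      have := crossCount_mono (G := G) (undominated_subset (G := G) H (insert u (D H)))
        (undominated_subset (G := G) K (insert u (D K)))
      have := hP.sep H hH K hK hne
      omega
    · intro z hz
      by_cases hzX : z ∈ X
      · exact mem_union_left _ (undominated_anti X (by simp) (mem_undominated_of_mem hz hzX))
      · have hzu : z ≠ u := fun h => notMem_undominated_of_mem (by simp [h]) hz
        obtain ⟨H, hH, hzH⟩ := hP.exists_mem (x := z)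
          (by simp [hzX, hzu, undominated_subset _ _ hz])
        exact mem_union_right _ (mem_biUnion.2 ⟨H, hH, undominated_anti H
          (insert_subset_insert u (subset_biUnion_of_mem D hH)) (mem_undominated_of_mem hz hzH)⟩)

lemma SmallIsolation.of_bridge {S X : Finset V} (hS : CutConnected G S) (hXS : X ⊂ S)
    (hX : X.Nonempty) (h : crossCount G X (S \ X) = 1)
    (ih : ∀ T ⊂ S, CutConnected G T → ¬ IsSquare4 G T → SmallIsolation G T) :
    SmallIsolation G S := by
  have hY : S \ X ⊂ S := sdiff_ssubset hXS.1 hX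
  have h' : crossCount G (S \ X) (S \ (S \ X)) = 1 := by
    rw [Finset.sdiff_sdiff_eq_self hXS.1, crossCount_comm, h]
  by_cases hsX : IsSquare4 G X
  · exact .of_bridge_square hS hXS.1 hsX h ih
  by_cases hsY : IsSquare4 G (S \ X)
  · exact .of_bridge_square hS hY.1 hsY h' ih
  obtain ⟨D, hD, hDf⟩ := ih X hXS (hS.of_crossCount_le_one hXS.1 hX h.le) hsX
  obtain ⟨E, hE, hEf⟩ := ih _ hY
    (hS.of_crossCount_le_one hY.1 (sdiff_nonempty.2 hXS.2) h'.le) hsY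
  refine ⟨D ∪ E, ?_, (hDf.union hEf ?_).mono ?_⟩
  · have h1 := card_union_le D E
    have h2 := crossCount_union_self (G := G) (X := X) (Y := S \ X) disjoint_sdiff
    rw [union_sdiff_of_subset hXS.1] at h2
    omega
  · exact h ▸ crossCount_mono (undominated_subset _ _) (undominated_subset _ _)
  · intro z hz
    by_cases hzX : z ∈ X
    · exact mem_union_left _ (undominated_anti X subset_union_left (mem_undominated_of_mem hz hzX))
    · exact mem_union_right _ (undominated_anti _ subset_union_right
        (mem_undominated_of_mem hz (mem_sdiff.2 ⟨undominated_subset _ _ hz, hzX⟩)))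

lemma longCycleFree_of_forall_exists_crossCount_le_one (T : Finset V)
    (h : ∀ X ⊆ T, X.Nonempty → ∃ x ∈ X, crossCount G {x} X ≤ 1) : LongCycleFree G T := by
  induction T using Finset.strongInduction with
  | H T ih =>
  rcases T.eq_empty_or_nonempty with rfl | hT
  · exact longCycleFree_of_card_le (by simp)
  obtain ⟨x, hx, hx1⟩ := h T subset_rfl hT
  have h1 := ih (T.erase x) (erase_ssubset hx) fun X hX => h X (hX.trans (erase_subset x T))
  rw [← insert_erase hx, insert_eq]
  refine LongCycleFree.union (longCycleFree_of_card_le (by simp)) h1 ?_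
  exact (crossCount_mono subset_rfl (erase_subset x T)).trans hx1

lemma SmallIsolation.of_degree_two {S : Finset V} (hS : CutConnected G S)
    (hsq : ¬ IsSquare4 G S) (h2 : ∀ v ∈ S, crossCount G {v} S = 2) : SmallIsolation G S := by
  by_cases h3 : #S ≤ 3
  · exact .of_longCycleFree (longCycleFree_of_card_le h3)
  have h5 : 5 ≤ #S := by
    by_contra h
    exact hsq ⟨by omega, h2⟩
  obtain ⟨v, hv⟩ := hS.1
  refine ⟨{v}, ?_, longCycleFree_of_forall_exists_crossCount_le_one _ fun X hX hXn => ?_⟩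
  · rw [crossCount_eq_sum, Finset.sum_congr rfl h2]
    simp
    omega
  · have hXS : X ⊆ S := hX.trans (undominated_subset _ _)
    have hvX : v ∉ X := fun h => notMem_undominated_of_mem (by simp) (hX h)
    obtain ⟨x, hx, y, hy, hxy⟩ := exists_adj_of_crossCount_ne_zero
      (hS.2 X ⟨hXS, fun h => hvX (h hv)⟩ hXn)
    refine ⟨x, hx, ?_⟩
    have h1 := crossCount_sdiff_right (G := G) hXS {x}
    have h4 := crossCount_pos (mem_singleton_self x) hy hxy
    have := h2 x (hXS hx)
    omega

variable (G) in
/-- `N` is the neighbourhood of `v` in `G[S]`, and `P` is the set of vertex sets of components of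
`G[S]` without the closed neighbourhood of `v`. -/
structure IsStarPartition (S : Finset V) (v : V) (N : Finset V) (P : Finset (Finset V)) :
    Prop where
  mem : v ∈ S
  nbhd : N = S.filter (G.Adj v)
  comps : IsComponents G (S \ insert v N) P

variable (G) in
/-- No cut of `G[S]` consists of at most one edge. -/
def TwoEdgeConnected (S : Finset V) : Prop :=
  S.Nonempty ∧ ∀ X ⊂ S, X.Nonempty → 2 ≤ crossCount G X (S \ X)

omit [DecidableEq V] in
lemma crossCount_le_of_adj {X Y X' Y' : Finset V}
    (h : ∀ x ∈ X, ∀ y ∈ Y, G.Adj x y → x ∈ X' ∧ y ∈ Y') :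
    crossCount G X Y ≤ crossCount G X' Y' := by
  simp only [crossCount_eq_card]
  refine card_le_card fun p hp => ?_
  simp only [mem_filter, mem_product] at hp ⊢
  exact ⟨h _ hp.1.1 _ hp.1.2 hp.2, hp.2⟩

omit [DecidableEq V] in
lemma crossCount_singleton_le (x : V) (Y : Finset V) : crossCount G {x} Y ≤ #Y := by
  rw [crossCount_singleton_left]
  exact card_filter_le _ _

namespace IsStarPartition

variable {S N : Finset V} {v : V} {P : Finset (Finset V)} (h : IsStarPartition G S v N P)
include h

lemma mem_nbhd {x : V} : x ∈ N ↔ x ∈ S ∧ G.Adj v x := by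
  rw [h.nbhd, mem_filter]

lemma center_notMem : v ∉ N := by
  simp [h.mem_nbhd]

lemma nbhd_subset : N ⊆ S := fun _ hx => (h.mem_nbhd.1 hx).1

lemma card_nbhd : crossCount G {v} S = #N := by
  rw [crossCount_singleton_left, h.nbhd]

lemma crossCount_center_nbhd : crossCount G {v} N = #N := by
  rw [crossCount_singleton_left, filter_true_of_mem fun x hx => (h.mem_nbhd.1 hx).2]

lemma of_mem_component {H : Finset V} (hH : H ∈ P) {x : V} (hx : x ∈ H) :
    x ∈ S ∧ x ≠ v ∧ x ∉ N := by
  have := h.comps.subset hH hx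
  simpa using this

lemma not_adj_center {H : Finset V} (hH : H ∈ P) {x : V} (hx : x ∈ H) : ¬ G.Adj v x := fun ha =>
  (h.of_mem_component hH hx).2.2 (h.mem_nbhd.2 ⟨(h.of_mem_component hH hx).1, ha⟩)

lemma ssubset {H : Finset V} (hH : H ∈ P) : H ⊂ S :=
  ⟨fun _ hx => (h.of_mem_component hH hx).1, fun hS => (h.of_mem_component hH (hS h.mem)).2.1 rfl⟩

lemma cases {z : V} (hz : z ∈ S) : z = v ∨ z ∈ N ∨ ∃ H ∈ P, z ∈ H := by
  by_cases h1 : z = v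
  · exact Or.inl h1
  by_cases h2 : z ∈ N
  · exact Or.inr (Or.inl h2)
  exact Or.inr (Or.inr (h.comps.exists_mem (by simp [*])))

lemma not_adj_components {H K : Finset V} (hH : H ∈ P) (hK : K ∈ P) (hne : H ≠ K) {x y : V}
    (hx : x ∈ H) (hy : y ∈ K) : ¬ G.Adj x y :=
  crossCount_eq_zero_iff.1 (h.comps.sep H hH K hK hne) x hx y hy

lemma adj_component {H : Finset V} (hH : H ∈ P) {x y : V} (hx : x ∈ H) (hy : y ∈ S)
    (hxy : G.Adj x y) : y ∈ N ∨ y ∈ H := by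
  rcases h.cases hy with rfl | hyN | ⟨K, hK, hyK⟩
  · exact absurd hxy.symm (h.not_adj_center hH hx)
  · exact Or.inl hyN
  · by_cases hne : H = K
    · exact Or.inr (hne ▸ hyK)
    · exact absurd hxy (h.not_adj_components hH hK hne hx hyK)

lemma crossCount_self :
    crossCount G S S = 2 * #N + crossCount G N N +
      ∑ H ∈ P, (crossCount G H H + 2 * crossCount G H N) := by
  have h1 := crossCount_union_self (G := G) (X := insert v N) (Y := S \ insert v N) disjoint_sdiff
  rw [union_sdiff_of_subset (insert_subset h.mem h.nbhd_subset), insert_eq,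
    crossCount_union_self (by simpa using h.center_notMem),
    crossCount_union_left (by simpa using h.center_notMem), h.crossCount_center_nbhd,
    crossCount_singleton_self, ← insert_eq, h.comps.crossCount_self] at h1
  have h2 : crossCount G {v} (S \ insert v N) = 0 := by
    rw [crossCount_eq_zero_iff]
    intro x hx y hy hxy
    rw [mem_singleton] at hx
    subst hx
    simp only [mem_sdiff, mem_insert, not_or] at hy
    exact hy.2.2 (h.mem_nbhd.2 ⟨hy.1, hxy⟩)
  rw [h2, crossCount_comm N (S \ insert v N), h.comps.crossCount_left] at h1
  rw [h1, Finset.sum_add_distrib, ← Finset.mul_sum]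
  omega

lemma two_le_crossCount (hS : TwoEdgeConnected G S) {H : Finset V} (hH : H ∈ P) :
    2 ≤ crossCount G H N := by
  refine (hS.2 H (h.ssubset hH) (h.comps.conn H hH).1).trans (crossCount_le_of_adj ?_)
  intro x hx y hy hxy
  rw [mem_sdiff] at hy
  exact ⟨hx, (h.adj_component hH hx hy.1 hxy).resolve_right hy.2⟩

lemma crossCount_undominated {H K D E : Finset V} (hH : H ∈ P) (hK : K ∈ P) (hne : H ≠ K) :
    crossCount G (undominated G H D) (undominated G K E) = 0 := by
  have := crossCount_mono (G := G) (undominated_subset (G := G) H D)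
    (undominated_subset (G := G) K E)
  have := h.comps.sep H hH K hK hne
  omega

/-- Isolation by the centre together with isolating sets of the components. -/
lemma smallIsolation_of_center (D : Finset V → Finset V)
    (hD : ∀ H ∈ P, LongCycleFree G (undominated G H (D H)))
    (hc : ∑ H ∈ P, 12 * #(D H) + 10 ≤ crossCount G S S) : SmallIsolation G S := by
  refine ⟨insert v (P.biUnion D), ?_, ?_⟩
  · have h1 : #(insert v (P.biUnion D)) ≤ ∑ H ∈ P, #(D H) + 1 :=
      (card_insert_le _ _).trans (Nat.succ_le_succ card_biUnion_le)
    rw [← Finset.mul_sum] at hc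
    omega
  · refine ((longCycleFree_of_card_le (T := ∅) (by simp)).union_biUnion P _ hD
      (fun H _ => by simp [crossCount])
      fun H hH K hK hne => h.crossCount_undominated hH hK hne).mono fun z hz => ?_
    rcases h.cases (undominated_subset _ _ hz) with rfl | hzN | ⟨H, hH, hzH⟩
    · exact absurd hz (notMem_undominated_of_mem (by simp))
    · exact absurd hz (notMem_undominated_of_adj (by simp) (h.mem_nbhd.1 hzN).2)
    · exact mem_union_right _ (mem_biUnion.2 ⟨H, hH, undominated_anti H
        ((subset_biUnion_of_mem D hH).trans (subset_insert _ _)) (mem_undominated_of_mem hz hzH)⟩)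

/-- Isolation by a neighbour `x` of the centre together with isolating sets of some of the
components. -/
lemma smallIsolation_of_leaf {x : V} (hx : x ∈ N) {Q R : Finset (Finset V)} (hQR : P = R ∪ Q)
    (hd : Disjoint R Q)
    (hB : LongCycleFree G (N.erase x ∪ R.biUnion fun H => undominated G H {x}))
    (D : Finset V → Finset V)
    (hD : ∀ H ∈ Q, LongCycleFree G (undominated G H (insert x (D H))))
    (hDN : ∀ H ∈ Q, crossCount G (undominated G H (insert x (D H))) (N.erase x) ≤ 1)
    (hc : ∑ H ∈ Q, 12 * #(D H) + 10 ≤ crossCount G S S) : SmallIsolation G S := by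
  refine ⟨insert x (Q.biUnion D), ?_, ?_⟩
  · have h1 : #(insert x (Q.biUnion D)) ≤ ∑ H ∈ Q, #(D H) + 1 :=
      (card_insert_le _ _).trans (Nat.succ_le_succ card_biUnion_le)
    rw [← Finset.mul_sum] at hc
    omega
  · have hR : ∀ H ∈ R, H ∈ P := fun H hH => hQR ▸ mem_union_left _ hH
    have hQ : ∀ H ∈ Q, H ∈ P := fun H hH => hQR ▸ mem_union_right _ hH
    refine (hB.union_biUnion Q (fun H => undominated G H (insert x (D H))) hD ?_
      fun H hH K hK hne => h.crossCount_undominated (hQ H hH) (hQ K hK) hne).mono fun z hz => ?_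
    · intro H hH
      have h0 : crossCount G (undominated G H (insert x (D H)))
          (R.biUnion fun H => undominated G H {x}) = 0 := by
        rw [crossCount_eq_zero_iff]
        intro y hy z hz
        obtain ⟨K, hK, hzK⟩ := mem_biUnion.1 hz
        exact h.not_adj_components (hQ H hH) (hR K hK)
          (fun he => disjoint_left.1 hd hK (he ▸ hH)) (undominated_subset _ _ hy)
          (undominated_subset _ _ hzK)
      have := hDN H hH
      have := crossCount_union_right_le (G := G) (N.erase x)
        (R.biUnion fun H => undominated G H {x}) (undominated G H (insert x (D H)))
      omega
    · rcases h.cases (undominated_subset _ _ hz) with rfl | hzN | ⟨H, hH, hzH⟩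
      · exact absurd hz (notMem_undominated_of_adj (by simp) (h.mem_nbhd.1 hx).2.symm)
      · have hzx : z ≠ x := fun he => notMem_undominated_of_mem (by simp [he]) hz
        exact mem_union_left _ (mem_union_left _ (mem_erase.2 ⟨hzx, hzN⟩))
      · rcases mem_union.1 (hQR ▸ hH) with hHR | hHQ
        · exact mem_union_left _ (mem_union_right _ (mem_biUnion.2 ⟨H, hHR,
            undominated_anti H (by simp) (mem_undominated_of_mem hz hzH)⟩))
        · exact mem_union_right _ (mem_biUnion.2 ⟨H, hHQ, undominated_anti H
            (insert_subset_insert x (subset_biUnion_of_mem D hHQ))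
            (mem_undominated_of_mem hz hzH)⟩)

/-- Isolation by a neighbour `x` of the centre that dominates enough of the component `K` to save
one vertex there. -/
lemma smallIsolation_of_leaf_of_saving {x : V} (hx : x ∈ N) (hN4 : #N ≤ 4)
    {K : Finset V} (hK : K ∈ P)
    (hD : ∀ H ∈ P, ∃ D : Finset V, LongCycleFree G (undominated G H (insert x D)) ∧
      crossCount G (undominated G H (insert x D)) (N.erase x) ≤ 1 ∧
      12 * #D + (if K = H then 12 else 0) ≤ crossCount G H H + 2 * crossCount G H N) :
    SmallIsolation G S := by
  choose! D hD hDN hDc using hD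
  refine h.smallIsolation_of_leaf hx (R := ∅) (Q := P) (by simp) (by simp) ?_ D hD hDN ?_
  · refine longCycleFree_of_card_le ?_
    simp [card_erase_of_mem hx]
    omega
  · have h1 := Finset.sum_le_sum hDc
    rw [Finset.sum_add_distrib, Finset.sum_ite_eq P K, if_pos hK] at h1
    have h2 := h.crossCount_self
    omega

end IsStarPartition

/-- A 4-cycle that loses a vertex incident with one of the two edges leaving it to `N`. -/
lemma IsSquare4.undominated_of_notMem {H N D : Finset V} (hH : IsSquare4 G H)
    (he : crossCount G H N = 2) {a x : V} (ha : a ∈ H) (hx : x ∈ N) (hax : G.Adj a x)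
    (haD : a ∉ _root_.undominated G H D) :
    LongCycleFree G (_root_.undominated G H D) ∧
      crossCount G (_root_.undominated G H D) N ≤ 1 := by
  have hs := undominated_subset_erase haD
  refine ⟨longCycleFree_of_subset_erase hH.1.le ha hs, ?_⟩
  have h1 := crossCount_mono (G := G) hs (subset_refl N)
  rw [erase_eq] at h1
  have h2 := crossCount_sdiff_left (G := G) (singleton_subset_iff.2 ha) N
  have h3 := crossCount_pos (mem_singleton_self a) hx hax
  omega

namespace IsStarPartition

variable {S N : Finset V} {v : V} {P : Finset (Finset V)} (h : IsStarPartition G S v N P)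
include h

lemma smallIsolation_of_forall_square (hN4 : #N ≤ 4) (hP : P.Nonempty)
    (hsq : ∀ H ∈ P, IsSquare4 G H ∧ crossCount G H N = 2) : SmallIsolation G S := by
  obtain ⟨K, hK⟩ := hP
  have hedge : ∀ H ∈ P, ∃ a ∈ H, ∃ x ∈ N, G.Adj a x := fun H hH =>
    exists_adj_of_crossCount_ne_zero (by rw [(hsq H hH).2]; omega)
  obtain ⟨b, hb, x, hx, hbx⟩ := hedge K hK
  refine h.smallIsolation_of_leaf_of_saving hx hN4 hK fun H hH => ?_
  have h8 := (hsq H hH).1.crossCount_self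
  have h2 := (hsq H hH).2
  by_cases hKH : K = H
  · subst hKH
    obtain ⟨h3, h4⟩ := (hsq K hK).1.undominated_of_notMem (D := insert x ∅) h2 hb hx hbx
      (notMem_undominated_of_adj (by simp) hbx.symm)
    exact ⟨∅, h3, (crossCount_mono subset_rfl (erase_subset _ _)).trans h4, by simp; omega⟩
  · obtain ⟨a, ha, y, hy, hay⟩ := hedge H hH
    obtain ⟨h3, h4⟩ := (hsq H hH).1.undominated_of_notMem (D := insert x {a}) h2 ha hy hay
      (notMem_undominated_of_mem (by simp))
    exact ⟨{a}, h3, (crossCount_mono subset_rfl (erase_subset _ _)).trans h4,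
      by simp [hKH]; omega⟩

/-- If the centre has three pairwise non-adjacent neighbours and the component `H` sends two edges
to them, then some neighbour is adjacent both to `H` and to another component. -/
lemma exists_common_nbhd (hS : TwoEdgeConnected G S) (hN3 : #N = 3)
    (hN0 : crossCount G N N = 0) {H : Finset V} (hH : H ∈ P) (h2 : crossCount G H N = 2) :
    ∃ x ∈ N, (∃ a ∈ H, G.Adj a x) ∧ ∃ K ∈ P, H ≠ K ∧ ∃ b ∈ K, G.Adj b x := by
  by_contra! hno
  set M := N.filter fun x => ∃ a ∈ H, G.Adj a x with hM
  have hMN : M ⊆ N := filter_subset _ _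
  have hM2 : #M ≤ 2 := by
    rw [← h2, crossCount_comm]
    refine le_trans ?_ (crossCount_mono (G := G) hMN (subset_refl H))
    rw [crossCount_eq_sum, card_eq_sum_ones]
    refine Finset.sum_le_sum fun x hx => ?_
    obtain ⟨a, ha, hax⟩ := (mem_filter.1 hx).2
    exact crossCount_pos (mem_singleton_self x) ha hax.symm
  have hMS : H ∪ M ⊆ S := union_subset (h.ssubset hH).1 (hMN.trans h.nbhd_subset)
  have hvHM : v ∉ H ∪ M := by
    simp only [mem_union, not_or]
    exact ⟨fun hv => (h.of_mem_component hH hv).2.1 rfl, fun hv => h.center_notMem (hMN hv)⟩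
  have hout : ∀ x ∈ H ∪ M, ∀ y ∈ S, y ∉ H ∪ M → G.Adj x y → x ∈ M ∧ y = v := by
    intro x hx y hy hyn hxy
    simp only [mem_union, not_or] at hx hyn
    rcases hx with hxH | hxM
    · have hyN := (h.adj_component hH hxH hy hxy).resolve_right hyn.1
      exact absurd (mem_filter.2 ⟨hyN, x, hxH, hxy⟩) hyn.2
    · refine ⟨hxM, ?_⟩
      rcases h.cases hy with hyv | hyN | ⟨K, hK, hyK⟩
      · exact hyv
      · exact absurd hxy (crossCount_eq_zero_iff.1 hN0 x (hMN hxM) y hyN)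
      · exact absurd hxy.symm (hno x (hMN hxM) (mem_filter.1 hxM).2 K hK
          (fun he => hyn.1 (he ▸ hyK)) y hyK)
  have hHn := (h.comps.conn H hH).1
  have hc1 := hS.2 (H ∪ M) ⟨hMS, fun hs => hvHM (hs h.mem)⟩ (hHn.mono subset_union_left)
  have hc2 : crossCount G (H ∪ M) (S \ (H ∪ M)) ≤ crossCount G M {v} := by
    refine crossCount_le_of_adj fun x hx y hy hxy => ?_
    rw [mem_sdiff] at hy
    simpa using hout x hx y hy.1 hy.2 hxy
  have hc3 : crossCount G M {v} ≤ #M := crossCount_comm (G := G) M {v} ▸ crossCount_singleton_le v M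
  have hNM : #(N \ M) = 3 - #M := by rw [card_sdiff_of_subset hMN, hN3]
  obtain ⟨z, hz⟩ : (N \ M).Nonempty := card_pos.1 (by omega)
  rw [mem_sdiff] at hz
  have hzX : z ∉ insert v (H ∪ M) := by
    simp only [mem_insert, mem_union, not_or]
    exact ⟨fun he => h.center_notMem (he ▸ hz.1),
      fun hzH => (h.of_mem_component hH hzH).2.2 hz.1, hz.2⟩
  have hc4 := hS.2 (insert v (H ∪ M))
    ⟨insert_subset h.mem hMS, fun hs => hzX (hs (h.nbhd_subset hz.1))⟩ (insert_nonempty _ _)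
  have hc5 : crossCount G (insert v (H ∪ M)) (S \ insert v (H ∪ M)) ≤
      crossCount G {v} (N \ M) := by
    refine crossCount_le_of_adj fun x hx y hy hxy => ?_
    simp only [mem_sdiff, mem_insert, not_or] at hx hy
    rcases hx with rfl | hx
    · refine ⟨mem_singleton_self x, mem_sdiff.2 ⟨h.mem_nbhd.2 ⟨hy.1, hxy⟩, fun hyM => ?_⟩⟩
      exact hy.2.2 (mem_union_right _ hyM)
    · exact absurd (hout x hx y hy.1 hy.2.2 hxy).2 hy.2.1
  have hc6 := crossCount_singleton_le (G := G) v (N \ M)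
  omega

lemma smallIsolation_of_one_nonsquare (hS : TwoEdgeConnected G S) (hN3 : #N = 3)
    (hN0 : crossCount G N N = 0) {H : Finset V} (hH : H ∈ P) (h2 : crossCount G H N = 2)
    (hI : SmallIsolation G H)
    (hsq : ∀ K ∈ P, K ≠ H → IsSquare4 G K ∧ crossCount G K N = 2) : SmallIsolation G S := by
  obtain ⟨x, hx, ⟨a, ha, hax⟩, K, hK, hHK, b, hb, hbx⟩ := h.exists_common_nbhd hS hN3 hN0 hH h2
  refine h.smallIsolation_of_leaf_of_saving hx (by omega) hK fun J hJ => ?_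
  by_cases hJH : J = H
  · subst hJH
    obtain ⟨D, hD, hf⟩ := hI
    refine ⟨D, hf.mono (undominated_anti J (subset_insert x D)), ?_, ?_⟩
    · refine (crossCount_mono (undominated_subset _ _) subset_rfl).trans ?_
      have h3 := crossCount_sdiff_right (G := G) (singleton_subset_iff.2 hx) J
      have h4 := crossCount_pos ha (mem_singleton_self x) hax
      rw [erase_eq]
      omega
    · rw [if_neg hHK.symm]
      omega
  obtain ⟨hJs, hJ2⟩ := hsq J hJ hJH
  have h8 := hJs.crossCount_self
  by_cases hKJ : K = J
  · subst hKJ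
    obtain ⟨h3, h4⟩ := hJs.undominated_of_notMem (D := insert x ∅) hJ2 hb hx hbx
      (notMem_undominated_of_adj (by simp) hbx.symm)
    exact ⟨∅, h3, (crossCount_mono subset_rfl (erase_subset _ _)).trans h4, by simp; omega⟩
  · obtain ⟨c, hc, y, hy, hcy⟩ := exists_adj_of_crossCount_ne_zero
      (by omega : crossCount G J N ≠ 0)
    obtain ⟨h3, h4⟩ := hJs.undominated_of_notMem (D := insert x {c}) hJ2 hc hy hcy
      (notMem_undominated_of_mem (by simp))
    exact ⟨{c}, h3, (crossCount_mono subset_rfl (erase_subset _ _)).trans h4,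
      by simp [hKJ]; omega⟩

lemma smallIsolation_of_one_square (hN3 : #N = 3)
    (hN0 : crossCount G N N = 0) {H : Finset V} (hH : H ∈ P) (h3 : crossCount G H N = 3)
    (hHsq : IsSquare4 G H)
    (hsq : ∀ K ∈ P, K ≠ H → IsSquare4 G K ∧ crossCount G K N = 2) : SmallIsolation G S := by
  obtain ⟨x, hx, hmax⟩ := exists_max_image N (fun y => crossCount G {y} H)
    (card_pos.1 (by omega))
  obtain ⟨y, z, hyz, hNx⟩ := card_eq_two.1 (by rw [card_erase_of_mem hx, hN3] : #(N.erase x) = 2)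
  have hyN : y ∈ N := mem_of_mem_erase (a := x) (by simp [hNx])
  have hzN : z ∈ N := mem_of_mem_erase (a := x) (by simp [hNx])
  have hsum : crossCount G {x} H + (crossCount G {y} H + crossCount G {z} H) = 3 := by
    rw [← h3, crossCount_comm H N, crossCount_eq_sum N H, ← Finset.add_sum_erase N _ hx, hNx,
      Finset.sum_pair hyz]
  have hxy := hmax y hyN
  have hxz := hmax z hzN
  obtain ⟨x', hx', a, ha, hxa⟩ := exists_adj_of_crossCount_ne_zero
    (by omega : crossCount G {x} H ≠ 0)
  rw [mem_singleton] at hx'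
  subst hx'
  have hZ : LongCycleFree G (undominated G H {x'}) := longCycleFree_of_subset_erase hHsq.1.le ha
    (undominated_subset_erase (notMem_undominated_of_adj (by simp) hxa))
  have hcard : ∀ u : V, LongCycleFree G {u} := fun u => longCycleFree_of_card_le (by simp)
  have hcu : ∀ u, crossCount G {u} (undominated G H {x'}) ≤ crossCount G {u} H := fun u =>
    crossCount_mono subset_rfl (undominated_subset _ _)
  have hB : LongCycleFree G ({y} ∪ ({z} ∪ undominated G H {x'})) := by
    refine (hcard y).union ((hcard z).union hZ ?_) ?_
    · have := hcu z
      omega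
    · have h1 := crossCount_union_right_le (G := G) {z} (undominated G H {x'}) {y}
      have h0 : crossCount G {y} {z} ≤ crossCount G N N :=
        crossCount_mono (by simpa using hyN) (by simpa using hzN)
      have := hcu y
      omega
  have hD : ∀ K ∈ P.erase H, ∃ D : Finset V,
      LongCycleFree G (undominated G K (insert x' D)) ∧
      crossCount G (undominated G K (insert x' D)) (N.erase x') ≤ 1 ∧
      12 * #D ≤ crossCount G K K + 2 * crossCount G K N := by
    intro K hK
    rw [mem_erase] at hK
    obtain ⟨hKs, hK2⟩ := hsq K hK.2 hK.1
    have h8 := hKs.crossCount_self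
    obtain ⟨c, hc, u, hu, hcu⟩ := exists_adj_of_crossCount_ne_zero
      (by omega : crossCount G K N ≠ 0)
    obtain ⟨h3, h4⟩ := hKs.undominated_of_notMem (D := insert x' {c}) hK2 hc hu hcu
      (notMem_undominated_of_mem (by simp))
    exact ⟨{c}, h3, (crossCount_mono subset_rfl (erase_subset _ _)).trans h4, by simp; omega⟩
  choose! D hD hDN hDc using hD
  refine h.smallIsolation_of_leaf hx (R := {H}) (Q := P.erase H)
    (by rw [← insert_eq, insert_erase hH]) (by simp) ?_ D hD hDN ?_
  · refine hB.mono ?_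
    rw [hNx, singleton_biUnion, insert_eq, union_assoc]
  · have h1 := Finset.sum_le_sum hDc
    have h2 := h.crossCount_self
    rw [← Finset.add_sum_erase P _ hH] at h2
    have h8 := hHsq.crossCount_self
    omega

lemma ten_le_crossCount_of_empty (hS : TwoEdgeConnected G S) (hN3 : 3 ≤ #N) (hP : P = ∅) :
    10 ≤ crossCount G S S := by
  subst hP
  have h1 := h.crossCount_self
  simp only [Finset.sum_empty, add_zero] at h1
  have h2 : ∑ x ∈ N, 1 ≤ ∑ x ∈ N, crossCount G {x} N := by
    refine Finset.sum_le_sum fun x hx => ?_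
    have hxS := h.nbhd_subset hx
    have hxv : x ≠ v := fun he => h.center_notMem (he ▸ hx)
    have h3 := hS.2 {x} ⟨by simpa using hxS, fun hs => hxv (mem_singleton.1 (hs h.mem)).symm⟩
      (singleton_nonempty x)
    have h4 : crossCount G {x} (S \ {x}) ≤ crossCount G {x} (N ∪ {v}) := by
      refine crossCount_mono subset_rfl fun y hy => ?_
      rcases h.cases (mem_sdiff.1 hy).1 with rfl | hyN | ⟨K, hK, _⟩
      · simp
      · exact mem_union_left _ hyN
      · simp at hK
    have h5 := crossCount_union_right_le (G := G) N {v} {x}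
    have h6 := crossCount_singleton_le (G := G) x {v}
    simp only [card_singleton] at h6
    omega
  rw [← crossCount_eq_sum, ← card_eq_sum_ones] at h2
  obtain ⟨k, hk⟩ := even_crossCount_self (G := G) N
  omega

lemma smallIsolation (hS : TwoEdgeConnected G S) (hN3 : 3 ≤ #N)
    (ih : ∀ T ⊂ S, CutConnected G T → ¬ IsSquare4 G T → SmallIsolation G T) :
    SmallIsolation G S := by
  rcases P.eq_empty_or_nonempty with hP | hP
  · refine h.smallIsolation_of_center (fun _ => ∅) (by simp [hP]) ?_
    simpa using h.ten_le_crossCount_of_empty hS hN3 hP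
  have hD : ∀ H ∈ P, ∃ D : Finset V, LongCycleFree G (undominated G H D) ∧
      12 * #D ≤ crossCount G H H + 2 * crossCount G H N ∧
      (¬ (IsSquare4 G H ∧ crossCount G H N = 2) →
        12 * #D + 2 ≤ crossCount G H H + 2 * crossCount G H N) ∧
      (12 * #D + 4 ≤ crossCount G H H + 2 * crossCount G H N ∨
        (IsSquare4 G H ∧ crossCount G H N ≤ 3) ∨
        (SmallIsolation G H ∧ ¬ IsSquare4 G H ∧ crossCount G H N = 2)) := by
    intro H hH
    have he := h.two_le_crossCount hS hH
    by_cases hsq : IsSquare4 G H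
    · obtain ⟨a, ha⟩ := (h.comps.conn H hH).1
      have h8 := hsq.crossCount_self
      refine ⟨{a}, longCycleFree_of_subset_erase hsq.1.le ha
        (undominated_subset_erase (notMem_undominated_of_mem (by simp))), ?_, ?_, ?_⟩
      · simp
        omega
      · simp [hsq]
        omega
      · simp [hsq]
        omega
    · obtain ⟨D, hD, hf⟩ := ih H (h.ssubset hH) (h.comps.conn H hH) hsq
      refine ⟨D, hf, by omega, fun _ => by omega, ?_⟩
      by_cases h2 : crossCount G H N = 2
      · exact Or.inr (Or.inr ⟨⟨D, hD, hf⟩, hsq, h2⟩)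
      · exact Or.inl (by omega)
  choose! D hD h0 h2 h4 using hD
  have htot := h.crossCount_self
  have hall := Finset.sum_le_sum h0
  by_cases hbad : ∀ H ∈ P, IsSquare4 G H ∧ crossCount G H N = 2
  · by_cases hN4 : #N ≤ 4
    · exact h.smallIsolation_of_forall_square hN4 hP hbad
    · exact h.smallIsolation_of_center D hD (by omega)
  push Not at hbad
  obtain ⟨H, hH, hHb⟩ := hbad
  by_contra hno
  have hlt : crossCount G S S < ∑ H ∈ P, 12 * #(D H) + 10 := by
    by_contra hge
    exact hno (h.smallIsolation_of_center D hD (by omega))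
  have hrest := Finset.sum_le_sum fun K (hK : K ∈ P.erase H) => h0 K (mem_of_mem_erase hK)
  rw [← Finset.add_sum_erase P _ hH] at htot
  rw [← Finset.add_sum_erase P (fun H => 12 * #(D H)) hH] at hlt
  have hH2 := h2 H hH (fun hc => hHb hc.1 hc.2)
  have hothers : ∀ K ∈ P, K ≠ H → IsSquare4 G K ∧ crossCount G K N = 2 := by
    intro K hK hKH
    by_contra hKb
    have hK' := mem_erase.2 ⟨hKH, hK⟩
    have hrest' := Finset.sum_le_sum fun J (hJ : J ∈ (P.erase H).erase K) =>
      h0 J (mem_of_mem_erase (mem_of_mem_erase hJ))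
    have hK2 := h2 K hK hKb
    rw [← Finset.add_sum_erase (P.erase H) _ hK'] at htot
    rw [← Finset.add_sum_erase (P.erase H) (fun H => 12 * #(D H)) hK'] at hlt
    omega
  obtain ⟨k, hk⟩ := even_crossCount_self (G := G) N
  have hN0 : crossCount G N N = 0 := by omega
  have hN3' : #N = 3 := by omega
  have he := h.two_le_crossCount hS hH
  rcases h4 H hH with h4 | ⟨hsq, h3⟩ | ⟨hI, hsq, h2⟩
  · omega
  · exact hno (h.smallIsolation_of_one_square hN3' hN0 hH
      (by have := hHb hsq; omega) hsq hothers)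
  · exact hno (h.smallIsolation_of_one_nonsquare hS hN3' hN0 hH h2 hI hothers)

end IsStarPartition

lemma smallIsolation_of_cutConnected (S : Finset V) (hS : CutConnected G S)
    (hsq : ¬ IsSquare4 G S) : SmallIsolation G S := by
  induction S using Finset.strongInduction with
  | H S ih =>
  by_cases hbr : ∃ X ⊂ S, X.Nonempty ∧ crossCount G X (S \ X) = 1
  · obtain ⟨X, hXS, hX, h1⟩ := hbr
    exact .of_bridge hS hXS hX h1 ih
  have h2S : TwoEdgeConnected G S := by
    refine ⟨hS.1, fun X hXS hX => ?_⟩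
    have h0 := hS.2 X hXS hX
    have h1 : crossCount G X (S \ X) ≠ 1 := fun h1 => hbr ⟨X, hXS, hX, h1⟩
    omega
  by_cases hdeg : ∃ v ∈ S, 3 ≤ crossCount G {v} S
  · obtain ⟨v, hv, h3⟩ := hdeg
    obtain ⟨P, hP⟩ := exists_isComponents G (S \ insert v (S.filter (G.Adj v)))
    have hstar : IsStarPartition G S v (S.filter (G.Adj v)) P := ⟨hv, rfl, hP⟩
    exact hstar.smallIsolation h2S (hstar.card_nbhd ▸ h3) ih
  push Not at hdeg
  by_cases hS1 : #S ≤ 3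
  · exact .of_longCycleFree (longCycleFree_of_card_le hS1)
  refine .of_degree_two hS hsq fun v hv => ?_
  have h1 := hdeg v hv
  have h2 := h2S.2 {v} ⟨by simpa using hv, fun hs => hS1 <| by
    have := card_le_card hs
    simp at this
    omega⟩ (singleton_nonempty v)
  have h3 := crossCount_mono (G := G) (subset_refl {v}) (sdiff_subset : S \ {v} ⊆ S)
  omega

lemma cutConnected_univ [Fintype V] (hG : G.Connected) : CutConnected G univ := by
  obtain ⟨v⟩ := hG.nonempty
  refine ⟨⟨v, mem_univ v⟩, fun X hX ⟨a, ha⟩ h0 => ?_⟩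
  obtain ⟨b, -, hb⟩ := exists_of_ssubset hX
  obtain ⟨p⟩ := hG.preconnected a b
  obtain ⟨d, -, hd1, hd2⟩ := p.exists_boundary_dart (X : Set V) ha hb
  exact crossCount_eq_zero_iff.1 h0 d.fst hd1 d.snd (by simpa using hd2) d.adj

omit [DecidableEq V] in
lemma crossCount_univ [Fintype V] : crossCount G univ univ = 2 * G.edgeSet.ncard := by
  rw [crossCount_eq_sum, ← coe_edgeFinset, Set.ncard_coe_finset,
    ← G.sum_degrees_eq_twice_card_edges]
  refine Finset.sum_congr rfl fun v _ => ?_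
  rw [crossCount_singleton_left, ← card_neighborFinset_eq_degree, neighborFinset_eq_filter]

lemma IsSquare4.nonempty_iso [Fintype V] (h : IsSquare4 G univ) :
    Nonempty (G ≃g cycleGraph 4) := by
  obtain ⟨h4, h2⟩ := h
  simp only [crossCount_singleton_left, mem_univ, true_imp_iff] at h2
  obtain ⟨a⟩ : Nonempty V := univ_nonempty_iff.1 (card_pos.1 (by omega))
  obtain ⟨b, d, hbd, hN⟩ := card_eq_two.1 (h2 a)
  have hab : G.Adj a b := by simpa using (Finset.ext_iff.1 hN b).2 (by simp)
  have had : G.Adj a d := by simpa using (Finset.ext_iff.1 hN d).2 (by simp)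
  have hNa : ∀ x, G.Adj a x → x = b ∨ x = d := fun x hx => by
    simpa using (Finset.ext_iff.1 hN x).1 (by simpa using hx)
  obtain ⟨c, hc⟩ : ∃ c, c ∉ ({a, b, d} : Finset V) := by
    by_contra! hall
    have := card_le_card (fun x _ => hall x : univ ⊆ ({a, b, d} : Finset V))
    have := card_le_three (a := a) (b := b) (c := d)
    omega
  simp only [mem_insert, mem_singleton, not_or] at hc
  have huniv : ({a, b, c, d} : Finset V) = univ := by
    refine eq_univ_of_card _ ?_
    rw [← card_univ, h4]
    have := hab.ne
    have := had.ne
    grind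
  have hmem : ∀ x, x = a ∨ x = b ∨ x = c ∨ x = d := fun x => by
    simpa using (Finset.ext_iff.1 huniv x).2 (mem_univ x)
  have hfull : ∀ p q r : V, univ.filter (G.Adj p) ⊆ {q, r} → G.Adj p q ∧ G.Adj p r := by
    intro p q r hs
    have he := eq_of_subset_of_card_le hs ((card_le_two).trans (h2 p).ge)
    exact ⟨by simpa using (Finset.ext_iff.1 he q).2 (by simp),
      by simpa using (Finset.ext_iff.1 he r).2 (by simp)⟩
  have hac : ¬ G.Adj a c := fun hac => by have := hNa c hac; tauto
  obtain ⟨hcb, hcd⟩ := hfull c b d fun x hx => by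
    have hx : G.Adj c x := by simpa using hx
    rcases hmem x with rfl | rfl | rfl | rfl
    · exact absurd hx.symm hac
    · simp
    · exact absurd hx G.irrefl
    · simp
  have hnbd : ¬ G.Adj b d := fun hadj => by
    have h3 : ({a, c, d} : Finset V) ⊆ univ.filter (G.Adj b) := by
      intro x hx
      simp only [mem_insert, mem_singleton] at hx
      rcases hx with rfl | rfl | rfl
      exacts [by simpa using hab.symm, by simpa using hcb.symm, by simpa using hadj]
    have h5 := card_le_card h3
    rw [h2 b, card_eq_three.2 ⟨a, c, d, Ne.symm hc.1, had.ne, hc.2.2, rfl⟩] at h5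
    omega
  let f : Fin 4 → V := ![a, b, c, d]
  have hf : Function.Surjective f := fun x => by
    rcases hmem x with rfl | rfl | rfl | rfl
    exacts [⟨0, rfl⟩, ⟨1, rfl⟩, ⟨2, rfl⟩, ⟨3, rfl⟩]
  have hfb : Function.Bijective f :=
    (Fintype.bijective_iff_surjective_and_card f).2
      ⟨hf, by rw [← card_univ (α := V), h4, Fintype.card_fin]⟩
  refine ⟨(RelIso.symm ⟨Equiv.ofBijective f hfb, ?_⟩)⟩
  intro i j
  fin_cases i <;> fin_cases j <;>
    simp [f, cycleGraph_adj, hab, hab.symm, had, had.symm, hcb, hcb.symm, hcd, hcd.symm, hac,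
      hnbd, G.adj_comm c a, G.adj_comm d b] <;> decide

end IsolationOfLongCycles

/-- If `G` is a connected graph with exactly `m` edges and `G` is not a
4-cycle, then `ι(G, 𝓒') ≤ (m+1)/6`, where `𝓒'` is the set of cycles of length at least 4. -/
theorem isolation_nonTriangleCycles_le {V : Type*} [Fintype V] (G : SimpleGraph V) (m : ℕ)
    (hm : G.edgeSet.ncard = m) (hconn : G.Connected)
    (hC4 : ¬ Nonempty (G ≃g cycleGraph 4)) :
    (iotaCycGE 4 G : ℝ) ≤ (m + 1) / 6 := by
  classical
  obtain ⟨D, hD, hf⟩ := smallIsolation_of_cutConnected Finset.univ (cutConnected_univ hconn)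
    fun h => hC4 h.nonempty_iso
  rw [crossCount_univ, hm] at hD
  have hi : iotaCycGE 4 G ≤ D.card := by
    refine Nat.sInf_le ⟨(D : Set V), Set.ncard_coe_finset D, ?_⟩
    rintro n hn ⟨f, hfi⟩
    refine hf n hn (fun i => (f i : V)) (Subtype.val_injective.comp hfi) (fun i => ?_)
      fun i j hij => f.map_adj hij
    have hfi := (f i).2
    simp only [closedNbhd, Set.mem_compl_iff, Set.mem_union, Finset.mem_coe, Set.mem_ofPred_eq,
      not_or, not_exists, not_and] at hfi
    simp only [undominated, Finset.mem_filter]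
    exact ⟨Finset.mem_univ _, hfi⟩
  have h6 : 6 * iotaCycGE 4 G ≤ m + 1 := by omega
  have h6' : (6 * iotaCycGE 4 G : ℝ) ≤ m + 1 := by exact_mod_cast h6
  linarith
end

section
/- For every positive integer q there exists a connected graph G with exactly 6q − 1 edges such that the 𝓒'-isolation number of G equals q, i.e. ι(G, 𝓒') = (|E(G)| + 1)/6; consequently the bound ι(G, 𝓒') ≤ (m+1)/6 for connected m-edge graphs other than the 4-cycle is attained by infinitely many pairwise non-isomorphic graphs. -/
open SimpleGraph

theorem closedNbhd_image_iso {V W : Type*} {G : SimpleGraph V} {H : SimpleGraph W}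
    (φ : G ≃g H) (D : Set V) : closedNbhd H (φ '' D) = φ '' closedNbhd G D := by
  ext w
  obtain ⟨v, rfl⟩ := φ.surjective w
  simp [closedNbhd, φ.map_adj_iff]

theorem IsCycIsolatingGE.image_iso {V W : Type*} {k : ℕ} {G : SimpleGraph V} {H : SimpleGraph W}
    (φ : G ≃g H) {D : Set V} (hD : IsCycIsolatingGE k G D) : IsCycIsolatingGE k H (φ '' D) := by
  rintro n hn ⟨f, hf⟩
  refine hD n hn ⟨⟨fun x => ⟨φ.symm (f x), fun h => (f x).2 ?_⟩, fun {a b} hab => ?_⟩, ?_⟩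
  · exact (closedNbhd_image_iso φ D).ge ⟨_, h, φ.apply_symm_apply _⟩
  · exact φ.symm.map_adj_iff.2 (f.map_adj hab)
  · intro a b hab
    exact hf (Subtype.ext (φ.symm.injective (congrArg Subtype.val hab)))

theorem iotaCycGE_congr {V W : Type*} (k : ℕ) {G : SimpleGraph V} {H : SimpleGraph W}
    (φ : G ≃g H) : iotaCycGE k G = iotaCycGE k H := by
  unfold iotaCycGE
  congr 1
  ext r
  constructor
  · rintro ⟨D, rfl, hD⟩
    exact ⟨φ '' D, Set.ncard_image_of_injective D φ.injective, hD.image_iso φ⟩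
  · rintro ⟨D, rfl, hD⟩
    exact ⟨φ.symm '' D, Set.ncard_image_of_injective D φ.symm.injective, hD.image_iso φ.symm⟩

/-- The edges of the linked lollipops: in the `i`-th block the 4-cycle `1, 2, 3, 4` with the pendant
edge `01`, and edges joining the pendant vertex of block `0` to those of all other blocks. -/
def lollipopEdge (k : ℕ) : (Fin (k + 1) × Fin 5) ⊕ Fin k → Sym2 (Fin (k + 1) × Fin 5)
  | .inl (i, j) => s((i, j), (i, if j = 4 then 1 else j + 1))
  | .inr i => s((0, 0), (i.succ, 0))

/-- `k + 1` copies of a 4-cycle with a pendant edge, linked by a star on their pendant vertices. -/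
def linkedLollipops (k : ℕ) : SimpleGraph (Fin (k + 1) × Fin 5) :=
  fromEdgeSet (Set.range (lollipopEdge k))

theorem lollipopEdge_injective (k : ℕ) : Function.Injective (lollipopEdge k) := by
  have hne (i : Fin k) : (0 : Fin (k + 1)) ≠ i.succ := (Fin.succ_ne_zero i).symm
  rintro (⟨i, j⟩ | i) (⟨i', j'⟩ | i') h <;>
    simp only [lollipopEdge, Sym2.eq_iff, Prod.mk.injEq] at h
  · have : i = i' := by tauto
    subst this
    have : j = j' := by
      simp only [true_and] at h
      revert j j'
      decide
    rw [this]
  · have := hne i'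
    grind
  · have := hne i
    grind
  · have : i = i' := by
      rcases h with h | h
      · exact Fin.succ_injective _ h.2.1
      · exact absurd h.1.1 (hne _)
    rw [this]

theorem lollipopEdge_not_isDiag (k : ℕ) (x) : ¬ (lollipopEdge k x).IsDiag := by
  rcases x with ⟨i, j⟩ | i
  · simp only [lollipopEdge, Sym2.mk_isDiag_iff, Prod.mk.injEq, true_and]
    revert j
    decide
  · simp [lollipopEdge, (Fin.succ_ne_zero i).symm]

theorem edgeSet_linkedLollipops (k : ℕ) :
    (linkedLollipops k).edgeSet = Set.range (lollipopEdge k) := by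
  rw [linkedLollipops, edgeSet_fromEdgeSet, sdiff_eq_left, Set.disjoint_left]
  rintro _ ⟨x, rfl⟩
  exact lollipopEdge_not_isDiag k x

theorem ncard_edgeSet_linkedLollipops (k : ℕ) :
    (linkedLollipops k).edgeSet.ncard = 6 * (k + 1) - 1 := by
  rw [edgeSet_linkedLollipops, ← Set.image_univ,
    Set.ncard_image_of_injective _ (lollipopEdge_injective k), Set.ncard_univ]
  simp only [Nat.card_eq_fintype_card, Fintype.card_sum, Fintype.card_prod, Fintype.card_fin]
  omega

theorem linkedLollipops_adj_iff {k : ℕ} {v w : Fin (k + 1) × Fin 5} :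
    (linkedLollipops k).Adj v w ↔ ∃ x, lollipopEdge k x = s(v, w) := by
  rw [← mem_edgeSet, edgeSet_linkedLollipops, Set.mem_range]

theorem linkedLollipops_adj_block {k : ℕ} (i : Fin (k + 1)) (j : Fin 5) :
    (linkedLollipops k).Adj (i, j) (i, if j = 4 then 1 else j + 1) :=
  linkedLollipops_adj_iff.2 ⟨.inl (i, j), rfl⟩

theorem linkedLollipops_adj_star {k : ℕ} (i : Fin k) :
    (linkedLollipops k).Adj (0, 0) (i.succ, 0) :=
  linkedLollipops_adj_iff.2 ⟨.inr i, rfl⟩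

theorem fst_eq_of_linkedLollipops_adj {k : ℕ} {v w : Fin (k + 1) × Fin 5}
    (h : (linkedLollipops k).Adj v w) (hw : w.2 ≠ 0) : v.1 = w.1 := by
  obtain ⟨⟨i, j⟩ | i, hx⟩ := linkedLollipops_adj_iff.1 h <;>
    simp only [lollipopEdge, Sym2.eq_iff] at hx <;>
    rcases hx with ⟨rfl, rfl⟩ | ⟨rfl, rfl⟩ <;> simp_all

theorem linkedLollipops_connected (k : ℕ) : (linkedLollipops k).Connected := by
  have hblock (i : Fin (k + 1)) (j : Fin 5) : (linkedLollipops k).Reachable (i, 0) (i, j) := by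
    have h (j) := (linkedLollipops_adj_block i j).reachable
    have h1 := h 0
    have h2 := h1.trans (h 1)
    have h3 := h2.trans (h 2)
    have h4 := h3.trans (h 3)
    fin_cases j
    exacts [.rfl, h1, h2, h3, h4]
  have hroot (v) : (linkedLollipops k).Reachable (0, 0) v := by
    obtain ⟨i, j⟩ := v
    refine .trans ?_ (hblock i j)
    cases i using Fin.cases with
    | zero => rfl
    | succ i => exact (linkedLollipops_adj_star i).reachable
  exact ⟨fun v w => (hroot v).symm.trans (hroot w)⟩

theorem exists_mem_block_of_isCycIsolatingGE {k : ℕ} {D : Set (Fin (k + 1) × Fin 5)}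
    (hD : IsCycIsolatingGE 4 (linkedLollipops k) D) (i : Fin (k + 1)) : ∃ d ∈ D, d.1 = i := by
  by_contra! h
  refine hD 4 le_rfl ⟨⟨fun j => ⟨(i, j.succ), ?_⟩, fun {a b} hab => ?_⟩, fun a b hab => ?_⟩
  · rintro (hj | ⟨u, hu, hadj⟩)
    · exact h _ hj rfl
    · exact h u hu (fst_eq_of_linkedLollipops_adj hadj (Fin.succ_ne_zero j))
  · have h' (j) := linkedLollipops_adj_block i j
    change (linkedLollipops k).Adj (i, a.succ) (i, b.succ)
    have hstep : (b.succ = if a.succ = 4 then 1 else a.succ + 1) ∨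
        a.succ = if b.succ = 4 then 1 else b.succ + 1 := by
      revert a b
      decide
    rcases hstep with hs | hs
    · exact hs ▸ h' a.succ
    · exact hs ▸ (h' b.succ).symm
  · simpa using hab

theorem isCycIsolatingGE_linkedLollipops (k : ℕ) :
    IsCycIsolatingGE 4 (linkedLollipops k) (Set.range fun i => (i, 1)) := by
  have hmem (v : Fin (k + 1) × Fin 5)
      (hv : v ∉ closedNbhd (linkedLollipops k) (Set.range fun i => (i, 1))) : v.2 = 3 := by
    obtain ⟨i, j⟩ := v
    have h (j) := linkedLollipops_adj_block i j
    contrapose! hv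
    fin_cases j
    · exact .inr ⟨_, ⟨i, rfl⟩, (h 0).symm⟩
    · exact .inl ⟨i, rfl⟩
    · exact .inr ⟨_, ⟨i, rfl⟩, h 1⟩
    · exact absurd rfl hv
    · exact .inr ⟨_, ⟨i, rfl⟩, (h 4).symm⟩
  rintro n hn ⟨f, hf⟩
  obtain ⟨m, rfl⟩ : ∃ m, n = m + 2 := ⟨n - 2, by omega⟩
  have hadj : (linkedLollipops k).Adj (f 0) (f 1) :=
    f.map_adj (cycleGraph_adj.2 (.inr (sub_zero _)))
  have h0 := hmem _ (f 0).2
  have h1 := hmem _ (f 1).2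
  refine hadj.ne (Prod.ext (fst_eq_of_linkedLollipops_adj hadj ?_) (h0.trans h1.symm))
  rw [h1]
  decide

theorem iotaCycGE_linkedLollipops (k : ℕ) : iotaCycGE 4 (linkedLollipops k) = k + 1 := by
  have hcard : (Set.range fun i : Fin (k + 1) => (i, (1 : Fin 5))).ncard = k + 1 := by
    rw [← Set.image_univ, Set.ncard_image_of_injective _ (Prod.mk_left_injective _),
      Set.ncard_univ, Nat.card_fin]
  apply le_antisymm
  · exact Nat.sInf_le ⟨_, hcard, isCycIsolatingGE_linkedLollipops k⟩
  · refine le_csInf ⟨_, _, hcard, isCycIsolatingGE_linkedLollipops k⟩ ?_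
    rintro _ ⟨D, rfl, hD⟩
    have himage : Prod.fst '' D = Set.univ :=
      Set.eq_univ_of_forall (exists_mem_block_of_isCycIsolatingGE hD)
    have := Set.ncard_image_le (f := Prod.fst) D.toFinite
    rwa [himage, Set.ncard_univ, Nat.card_fin] at this

/-- For every positive integer `q` there exists a connected graph `G` with
exactly `6q − 1` edges such that `ι(G, 𝓒') = q`, i.e. `ι(G, 𝓒') = (|E(G)| + 1)/6`; hence the
bound `ι(G, 𝓒') ≤ (m+1)/6` is attained by infinitely many pairwise non-isomorphic graphs. -/
theorem exists_extremal_graph_nonTriangleCycles (q : ℕ) (hq : 1 ≤ q) :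
    ∃ (n : ℕ) (G : SimpleGraph (Fin n)), G.Connected ∧
      G.edgeSet.ncard = 6 * q - 1 ∧ iotaCycGE 4 G = q ∧
      (iotaCycGE 4 G : ℝ) = (G.edgeSet.ncard + 1) / 6 := by
  obtain ⟨k, rfl⟩ : ∃ k, q = k + 1 := ⟨q - 1, by omega⟩
  let e : Fin (k + 1) × Fin 5 ≃ Fin ((k + 1) * 5) := finProdFinEquiv
  let φ := Iso.map e (linkedLollipops k)
  have hedge : ((linkedLollipops k).map e).edgeSet.ncard = 6 * (k + 1) - 1 := by
    rw [← ncard_edgeSet_linkedLollipops]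
    exact (Nat.card_congr φ.mapEdgeSet).symm
  have hiota : iotaCycGE 4 ((linkedLollipops k).map e) = k + 1 := by
    rw [← iotaCycGE_congr 4 φ, iotaCycGE_linkedLollipops]
  refine ⟨_, _, φ.connected_iff.1 (linkedLollipops_connected k), hedge, hiota, ?_⟩
  rw [hedge, hiota, Nat.cast_sub (by omega)]
  push_cast
  ring
end

section
/- If G is a connected graph with exactly n vertices and G is not a triangle, then the 𝓒-isolation number of G satisfies ι(G, 𝓒) ≤ n/4. -/
open SimpleGraph

namespace CycleIsolation

open Finset

open scoped Classical

variable {V : Type*} (G : SimpleGraph V)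

/-- A nonempty vertex set in which every vertex has two neighbours. -/
def IsCore (C : Finset V) : Prop :=
  C.Nonempty ∧ ∀ v ∈ C, ∃ a ∈ C, ∃ b ∈ C, a ≠ b ∧ G.Adj v a ∧ G.Adj v b

/-- `A` is a union of components of the subgraph induced by `S`. -/
def IsClosedIn (A S : Finset V) : Prop :=
  A ⊆ S ∧ ∀ a ∈ A, ∀ b ∈ S, G.Adj a b → b ∈ A

/-- `D` meets the closed neighbourhood of every core contained in `S`. -/
def Isolates (S D : Finset V) : Prop :=
  ∀ C ⊆ S, IsCore G C → ∃ c ∈ C, ∃ d ∈ D, d = c ∨ G.Adj d c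

/-- The closed neighbourhood of `v` within `S`. -/
noncomputable def nbhd (S : Finset V) (v : V) : Finset V :=
  {w ∈ S | w = v ∨ G.Adj v w}

/-- The triangle components of the subgraph induced by `S`. -/
noncomputable def triComps (S : Finset V) : Finset (Finset V) :=
  {T ∈ S.powerset | G.IsNClique 3 T ∧ IsClosedIn G T S}

/-- The part of `S` outside its triangle components. -/
noncomputable def nonTri (S : Finset V) : Finset V :=
  S \ (triComps G S).biUnion id

variable {G}

lemma mem_triComps {S T : Finset V} :
    T ∈ triComps G S ↔ G.IsNClique 3 T ∧ IsClosedIn G T S := by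
  simp only [triComps, mem_filter, mem_powerset]
  exact ⟨fun h => h.2, fun h => ⟨h.2.1, h⟩⟩

lemma mem_nbhd {S : Finset V} {v w : V} :
    w ∈ nbhd G S v ↔ w ∈ S ∧ (w = v ∨ G.Adj v w) := by
  simp [nbhd]

lemma mem_nonTri {S : Finset V} {w : V} :
    w ∈ nonTri G S ↔ w ∈ S ∧ ∀ T ∈ triComps G S, w ∉ T := by
  simp [nonTri]

lemma nbhd_subset (S : Finset V) (v : V) : nbhd G S v ⊆ S := filter_subset _ _

lemma IsCore.inter {C A S : Finset V} (hC : IsCore G C) (hCS : C ⊆ S)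
    (hA : IsClosedIn G A S) (hne : (C ∩ A).Nonempty) : IsCore G (C ∩ A) := by
  refine ⟨hne, fun v hv => ?_⟩
  rw [mem_inter] at hv
  obtain ⟨a, ha, b, hb, hab, h1, h2⟩ := hC.2 v hv.1
  exact ⟨a, mem_inter.2 ⟨ha, hA.2 v hv.2 a (hCS ha) h1⟩, b,
    mem_inter.2 ⟨hb, hA.2 v hv.2 b (hCS hb) h2⟩, hab, h1, h2⟩

lemma IsCore.exists_three {C : Finset V} (hC : IsCore G C) {v : V} (hv : v ∈ C) :
    ∃ a b, G.Adj v a ∧ G.Adj v b ∧ a ≠ b ∧ ({v, a, b} : Finset V) ⊆ C ∧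
      ({v, a, b} : Finset V).card = 3 := by
  obtain ⟨a, ha, b, hb, hab, h1, h2⟩ := hC.2 v hv
  refine ⟨a, b, h1, h2, hab, ?_, card_eq_three.2 ⟨v, a, b, h1.ne, h2.ne, hab, rfl⟩⟩
  simp [insert_subset_iff, hv, ha, hb]

lemma IsCore.three_le_card {C : Finset V} (hC : IsCore G C) : 3 ≤ C.card := by
  obtain ⟨v, hv⟩ := hC.1
  obtain ⟨a, b, -, -, -, h, h3⟩ := hC.exists_three hv
  exact h3 ▸ card_le_card h

lemma IsCore.isNClique {C : Finset V} (hC : IsCore G C) (h3 : C.card = 3) :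
    G.IsNClique 3 C := by
  refine ⟨fun u hu w hw huw => ?_, h3⟩
  obtain ⟨a, b, ha, hb, -, h, hc⟩ := hC.exists_three hu
  have : w ∈ ({u, a, b} : Finset V) := by
    rw [eq_of_subset_of_card_le h (by omega)]; exact hw
  simp only [mem_insert, mem_singleton] at this
  rcases this with rfl | rfl | rfl
  · exact absurd rfl huw
  · exact ha
  · exact hb

lemma IsClosedIn.sdiff {A S : Finset V} (hA : IsClosedIn G A S) : IsClosedIn G (S \ A) S := by
  refine ⟨sdiff_subset, fun a ha b hb hab => ?_⟩
  rw [mem_sdiff] at ha ⊢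
  exact ⟨hb, fun h => ha.2 (hA.2 b h a ha.1 hab.symm)⟩

lemma IsClosedIn.trans {A B S : Finset V} (hA : IsClosedIn G A B) (hB : IsClosedIn G B S) :
    IsClosedIn G A S :=
  ⟨hA.1.trans hB.1, fun a ha b hb hab => hA.2 a ha b (hB.2 a (hA.1 ha) b hb hab) hab⟩

lemma Isolates.union {A S D E : Finset V} (hA : IsClosedIn G A S) (hD : Isolates G A D)
    (hE : Isolates G (S \ A) E) : Isolates G S (D ∪ E) := by
  intro C hCS hC
  by_cases hne : (C ∩ A).Nonempty
  · obtain ⟨c, hc, d, hd, h⟩ := hD _ inter_subset_right (hC.inter hCS hA hne)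
    exact ⟨c, (mem_inter.1 hc).1, d, mem_union_left _ hd, h⟩
  · obtain ⟨c, hc, d, hd, h⟩ := hE C (fun x hx => mem_sdiff.2 ⟨hCS hx, fun hxA =>
      hne ⟨x, mem_inter.2 ⟨hx, hxA⟩⟩⟩) hC
    exact ⟨c, hc, d, mem_union_right _ hd, h⟩

lemma Isolates.of_sdiff_nbhd {S D : Finset V} {y : V} (hy : y ∈ D)
    (h : Isolates G (S \ nbhd G S y) D) : Isolates G S D := by
  intro C hCS hC
  by_cases hd : ∃ c ∈ C, c ∈ nbhd G S y
  · obtain ⟨c, hc, hcy⟩ := hd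
    exact ⟨c, hc, y, hy, (mem_nbhd.1 hcy).2.imp Eq.symm id⟩
  · push Not at hd
    exact h C (fun x hx => mem_sdiff.2 ⟨hCS hx, hd x hx⟩) hC

lemma Isolates.mono {S D E : Finset V} (h : Isolates G S D) (hDE : D ⊆ E) :
    Isolates G S E := fun C hCS hC =>
  let ⟨c, hc, d, hd, hcd⟩ := h C hCS hC
  ⟨c, hc, d, hDE hd, hcd⟩

lemma eq_of_mem_triComps {S T U : Finset V} (hT : T ∈ triComps G S) (hU : U ∈ triComps G S)
    {w : V} (hwT : w ∈ T) (hwU : w ∈ U) : T = U := by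
  rw [mem_triComps] at hT hU
  refine eq_of_subset_of_card_le (fun z hz => ?_) (by rw [hT.1.2, hU.1.2])
  by_cases hzw : z = w
  · exact hzw ▸ hwU
  · exact hU.2.2 w hwU z (hT.2.1 hz) (hT.1.1 hwT hz (Ne.symm hzw))

lemma isClosedIn_nonTri (S : Finset V) : IsClosedIn G (nonTri G S) S := by
  refine ⟨sdiff_subset, fun a ha b hb hab => ?_⟩
  rw [mem_nonTri] at ha ⊢
  exact ⟨hb, fun T hT hbT => ha.2 T hT ((mem_triComps.1 hT).2.2 b hbT a ha.1 hab.symm)⟩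

lemma triComps_nonTri (S : Finset V) : triComps G (nonTri G S) = ∅ := by
  refine eq_empty_of_forall_notMem fun T hT => ?_
  have hT' := mem_triComps.1 hT
  have hTS : T ∈ triComps G S :=
    mem_triComps.2 ⟨hT'.1, hT'.2.trans (isClosedIn_nonTri S)⟩
  obtain ⟨t, ht⟩ := card_pos.1 (by rw [hT'.1.2]; norm_num : 0 < T.card)
  exact (mem_nonTri.1 (hT'.2.1 ht)).2 T hTS ht

lemma card_eq_nonTri_add (S : Finset V) :
    S.card = (nonTri G S).card + 3 * (triComps G S).card := by
  have h1 : ((triComps G S).biUnion id).card = 3 * (triComps G S).card := by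
    rw [card_biUnion, sum_const_nat (m := 3) (f := fun T => (id T).card)
      fun T hT => (mem_triComps.1 hT).1.2, mul_comm]
    intro T hT U hU hTU
    exact Finset.disjoint_left.2 fun w hw hw' => hTU (eq_of_mem_triComps hT hU hw hw')
  have h2 : (triComps G S).biUnion id ⊆ S := by
    intro w hw
    obtain ⟨T, hT, hwT⟩ := mem_biUnion.1 hw
    exact (mem_triComps.1 hT).2.1 hwT
  rw [nonTri, ← h1, card_sdiff_add_card_eq_card h2]

lemma Isolates.of_nonTri {S D : Finset V} (hR : Isolates G (nonTri G S) D)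
    (hT : ∀ T ∈ triComps G S, ∃ t ∈ T, ∃ d ∈ D, d = t ∨ G.Adj d t) : Isolates G S D := by
  intro C hCS hC
  by_cases hsub : C ⊆ nonTri G S
  · exact hR C hsub hC
  obtain ⟨c, hc, hcR⟩ := not_subset.1 hsub
  simp only [mem_nonTri, not_and, not_forall, not_not] at hcR
  obtain ⟨T, hTS, hcT⟩ := hcR (hCS hc)
  have hCT := hC.inter hCS (mem_triComps.1 hTS).2 ⟨c, mem_inter.2 ⟨hc, hcT⟩⟩
  have heq : C ∩ T = T := eq_of_subset_of_card_le inter_subset_right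
    (by rw [(mem_triComps.1 hTS).1.2]; exact hCT.three_le_card)
  obtain ⟨t, ht, h⟩ := hT T hTS
  exact ⟨t, (mem_inter.1 (heq ▸ ht)).1, h⟩

variable (G) in
/-- `S` has no nontrivial decomposition into unions of components. -/
def IsConn (S : Finset V) : Prop := ∀ A, A.Nonempty → IsClosedIn G A S → A = S

lemma IsConn.exists_adj {S T : Finset V} {v : V} (hS : IsConn G S) (hv : v ∈ S)
    (hT : T ∈ triComps G (S \ nbhd G S v)) :
    ∃ x ∈ S, G.Adj v x ∧ ∃ t ∈ T, G.Adj x t := by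
  by_contra! hcon
  have hT' := mem_triComps.1 hT
  have hTS : T ⊆ S := hT'.2.1.trans sdiff_subset
  have : T = S := by
    refine hS T (card_pos.1 (by rw [hT'.1.2]; norm_num)) ⟨hTS, fun a ha b hb hab => ?_⟩
    have ha' := hT'.2.1 ha
    by_cases hvb : b ∈ nbhd G S v
    · rcases (mem_nbhd.1 hvb).2 with rfl | h
      · exact absurd (mem_nbhd.2 ⟨hTS ha, Or.inr hab.symm⟩) (mem_sdiff.1 ha').2
      · exact absurd hab.symm (hcon b hb h a ha)
    · exact hT'.2.2 a ha b (mem_sdiff.2 ⟨hb, hvb⟩) hab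
  have hvT := hT'.2.1 (this ▸ hv : v ∈ T)
  exact (mem_sdiff.1 hvT).2 (mem_nbhd.2 ⟨hv, Or.inl rfl⟩)

lemma exists_isolates_of_two_linked {S : Finset V} (hS : IsConn G S) {v x : V}
    (hv : v ∈ S) (hx : x ∈ S) (hvx : G.Adj v x) {T₁ T₂ D : Finset V}
    (hT₁ : T₁ ∈ triComps G (S \ nbhd G S v)) (hT₂ : T₂ ∈ triComps G (S \ nbhd G S v))
    (hne : T₁ ≠ T₂) (h₁ : ∃ t ∈ T₁, G.Adj x t) (h₂ : ∃ t ∈ T₂, G.Adj x t)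
    (hD : Isolates G (nonTri G (S \ nbhd G S v)) D)
    (hcard : 4 * D.card ≤ (nonTri G (S \ nbhd G S v)).card) :
    ∃ E : Finset V, 4 * E.card ≤ S.card ∧ Isolates G S E := by
  set 𝒯 := triComps G (S \ nbhd G S v) with h𝒯
  have hex : ∀ T ∈ 𝒯, ∃ x, x ∈ S ∧ G.Adj v x ∧ ∃ t ∈ T, G.Adj x t := fun T hT =>
    hS.exists_adj hv hT
  have : Nonempty V := ⟨v⟩
  choose! f hfS hfv hft using hex
  set 𝒰 := {T ∈ 𝒯 | ¬ ∃ t ∈ T, G.Adj x t} with h𝒰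
  set X := 𝒰.image f with hX
  have hvX : insert v (insert x X) ⊆ nbhd G S v := by
    intro w hw
    simp only [mem_insert, hX, mem_image, h𝒰, mem_filter] at hw
    rw [mem_nbhd]
    rcases hw with rfl | rfl | ⟨T, ⟨hT, -⟩, rfl⟩
    · exact ⟨hv, Or.inl rfl⟩
    · exact ⟨hx, Or.inr hvx⟩
    · exact ⟨hfS T hT, Or.inr (hfv T hT)⟩
  have hxX : x ∉ X := by
    simp only [hX, mem_image, h𝒰, mem_filter, not_exists, not_and]
    rintro T ⟨hT, hn⟩ rfl
    obtain ⟨t, ht, hxt⟩ := hft T hT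
    exact hn t ht hxt
  have hvX' : v ∉ insert x X := by
    simp only [hX, mem_insert, mem_image, h𝒰, mem_filter, not_or, not_exists, not_and]
    refine ⟨hvx.ne, ?_⟩
    rintro T ⟨hT, -⟩ he
    exact (hfv T hT).ne he.symm
  have hcX : (insert v (insert x X)).card = X.card + 2 := by
    rw [card_insert_of_notMem hvX', card_insert_of_notMem hxX]
  have hXU : X.card ≤ 𝒰.card := card_image_le
  have hUT : 𝒰.card + 2 ≤ 𝒯.card := by
    have h2 : ({T₁, T₂} : Finset (Finset V)).card = 2 := card_pair hne
    rw [← h2, ← card_union_of_disjoint]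
    · refine card_le_card (union_subset (filter_subset _ _) ?_)
      simp [insert_subset_iff, hT₁, hT₂]
    · rw [Finset.disjoint_left]
      intro T hT hT'
      simp only [mem_insert, mem_singleton] at hT'
      have := (mem_filter.1 hT).2
      rcases hT' with rfl | rfl <;> contradiction
  have hS1 := card_sdiff_add_card_eq_card (nbhd_subset (G := G) S v)
  have hS2 := card_eq_nonTri_add (G := G) (S \ nbhd G S v)
  rw [← h𝒯] at hS2
  have hS3 := card_le_card hvX
  refine ⟨insert v (insert x X) ∪ D, ?_, ?_⟩
  · have := card_union_le (insert v (insert x X)) D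
    omega
  · refine Isolates.of_sdiff_nbhd (y := v) (by simp) (Isolates.of_nonTri
      (hD.mono subset_union_right) fun T hT => ?_)
    by_cases hxT : ∃ t ∈ T, G.Adj x t
    · obtain ⟨t, ht, hxt⟩ := hxT
      exact ⟨t, ht, x, by simp, Or.inr hxt⟩
    · obtain ⟨t, ht, hxt⟩ := hft T hT
      have : f T ∈ X := mem_image_of_mem f (mem_filter.2 ⟨hT, hxT⟩)
      exact ⟨t, ht, f T, by simp [this], Or.inr hxt⟩

variable (G) in
/-- Every proper subset of `S` satisfies the isolation bound. -/
def BoundBelow (S : Finset V) : Prop :=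
  ∀ U, U ⊂ S → triComps G U = ∅ → ∃ D : Finset V, 4 * D.card ≤ U.card ∧ Isolates G U D

lemma Isolates.anti {S U D : Finset V} (h : Isolates G S D) (hU : U ⊆ S) :
    Isolates G U D := fun C hCU hC => h C (hCU.trans hU) hC

lemma BoundBelow.of_vertex {S : Finset V} (ih : BoundBelow G S) {y : V} (hy : y ∈ S)
    (h4 : 4 ≤ (nbhd G S y).card) (ht : triComps G (S \ nbhd G S y) = ∅) :
    ∃ E : Finset V, 4 * E.card ≤ S.card ∧ Isolates G S E := by
  have hss : S \ nbhd G S y ⊂ S :=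
    sdiff_ssubset (nbhd_subset S y) ⟨y, mem_nbhd.2 ⟨hy, Or.inl rfl⟩⟩
  obtain ⟨D, hD, hDi⟩ := ih _ hss ht
  refine ⟨insert y D, ?_, Isolates.of_sdiff_nbhd (mem_insert_self y D)
    (hDi.mono (subset_insert y D))⟩
  have h1 := card_sdiff_add_card_eq_card (nbhd_subset (G := G) S y)
  have h2 := card_insert_le y D
  omega

lemma card_nbhd_ge_five {S : Finset V} {w c₁ c₂ c₃ c₄ : V} (hw : w ∈ S) (h₁ : c₁ ∈ S)
    (h₂ : c₂ ∈ S) (h₃ : c₃ ∈ S) (h₄ : c₄ ∈ S) (a₁ : G.Adj w c₁) (a₂ : G.Adj w c₂)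
    (a₃ : G.Adj w c₃) (a₄ : G.Adj w c₄) (hn : [c₁, c₂, c₃, c₄].Nodup) :
    5 ≤ (nbhd G S w).card := by
  have hsub : ({w, c₁, c₂, c₃, c₄} : Finset V) ⊆ nbhd G S w := by
    simp [insert_subset_iff, mem_nbhd, *]
  have hc : ({w, c₁, c₂, c₃, c₄} : Finset V).card = 5 := by
    simp only [List.nodup_cons, List.mem_cons, List.not_mem_nil, or_false, not_or] at hn
    have := a₁.ne
    have := a₂.ne
    have := a₃.ne
    have := a₄.ne
    rw [card_insert_of_notMem, card_insert_of_notMem, card_insert_of_notMem, card_pair] <;>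
      simp_all
  exact hc ▸ card_le_card hsub

lemma BoundBelow.of_adj_between_triangles {S R : Finset V} (ih : BoundBelow G S)
    {v a b x y p q : V}
    (hn : [v, a, b, x, y, p, q].Nodup)
    (hsub : ∀ w ∈ ({v, a, b, x, y, p, q} : Finset V), w ∈ S)
    (hcover : ∀ w ∈ S, w ∈ ({v, a, b, x, y, p, q} : Finset V) ∨ w ∈ R)
    (hRS : R ⊆ S) (hRt : triComps G R = ∅)
    (hRadj : ∀ r ∈ R, ∀ w ∈ ({v, a, b, y, p, q} : Finset V), ¬ G.Adj w r)
    (hdeg : ∀ w ∈ S, (nbhd G S w).card ≤ 4)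
    (hva : G.Adj v a) (hvb : G.Adj v b) (hab : G.Adj a b) (hxy : G.Adj x y)
    (hyp : G.Adj y p) (hyq : G.Adj y q) (hap : G.Adj a p) (hxq : ¬ G.Adj x q) :
    ∃ E : Finset V, 4 * E.card ≤ S.card ∧ Isolates G S E := by
  simp only [List.nodup_cons, List.mem_cons, List.not_mem_nil, or_false, not_or,
    not_false_eq_true, List.nodup_nil, and_true] at hn
  simp only [mem_insert, mem_singleton, forall_eq_or_imp, forall_eq] at hsub
  obtain ⟨hv, ha, hb, hx, hy, hp, hq⟩ := hsub
  have hout : ∀ w ∈ S, w ≠ v → w ≠ b → w ≠ p → ¬ G.Adj a w := by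
    intro w hw h1 h2 h3 haw
    have := card_nbhd_ge_five ha hv hb hp hw hva.symm hab hap haw
      (by simp; grind)
    have := hdeg a ha
    omega
  refine ih.of_vertex ha ?_ (eq_empty_of_forall_notMem fun U hU => ?_)
  · have hs : ({a, v, b, p} : Finset V) ⊆ nbhd G S a := by
      simp [insert_subset_iff, mem_nbhd, *, hva.symm]
    have hc : ({a, v, b, p} : Finset V).card = 4 := by
      rw [card_insert_of_notMem, card_insert_of_notMem, card_pair] <;> grind
    exact hc ▸ card_le_card hs
  · have hU' := mem_triComps.1 hU
    have hmem : ∀ w, w ∈ S → w ≠ a → w ≠ v → w ≠ b → w ≠ p → w ∈ S \ nbhd G S a := by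
      intro w hw h1 h2 h3 h4
      rw [mem_sdiff, mem_nbhd]
      have := hout w hw h2 h3 h4
      grind
    have hx' : x ∈ S \ nbhd G S a := hmem x hx (by grind) (by grind) (by grind) (by grind)
    have hy' : y ∈ S \ nbhd G S a := hmem y hy (by grind) (by grind) (by grind) (by grind)
    have hq' : q ∈ S \ nbhd G S a := hmem q hq (by grind) (by grind) (by grind) (by grind)
    have hUcl := hU'.2.2
    have hyU : y ∉ U := fun hyU =>
      hxq (hU'.1.1 (hUcl y hyU x hx' hxy.symm) (hUcl y hyU q hq' hyq) (by grind))
    have hxU : x ∉ U := fun h => hyU (hUcl x h y hy' hxy)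
    have hqU : q ∉ U := fun h => hyU (hUcl q h y hy' hyq.symm)
    have hUR : U ⊆ R := by
      intro w hw
      have hw' := hU'.2.1 hw
      rw [mem_sdiff, mem_nbhd] at hw'
      rcases hcover w hw'.1 with h | h
      · exfalso
        simp only [mem_insert, mem_singleton] at h
        rcases h with rfl | rfl | rfl | rfl | rfl | rfl | rfl
        · exact hw'.2 ⟨hv, Or.inr hva.symm⟩
        · exact hw'.2 ⟨ha, Or.inl rfl⟩
        · exact hw'.2 ⟨hb, Or.inr hab⟩
        · exact hxU hw
        · exact hyU hw
        · exact hw'.2 ⟨hp, Or.inr hap⟩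
        · exact hqU hw
      · exact h
    have : U ∈ triComps G R := by
      refine mem_triComps.2 ⟨hU'.1, hUR, fun c hc d hd hcd => ?_⟩
      have hc' := hUR hc
      refine hUcl c hc d (mem_sdiff.2 ⟨hRS hd, fun hdn => ?_⟩) hcd
      rcases (mem_nbhd.1 hdn).2 with rfl | h
      · exact hRadj c hc' d (by simp) hcd.symm
      · exact hRadj d hd a (by simp) h
    simp [hRt] at this

lemma IsCore.of_subset_four {C : Finset V} (hC : IsCore G C) {a b p q : V}
    (hsub : C ⊆ {a, b, p, q}) (hb : ¬ (G.Adj b p ∧ G.Adj b q))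
    (hp : ¬ (G.Adj p a ∧ G.Adj p b)) (hq : ¬ (G.Adj q a ∧ G.Adj q b)) :
    p ∈ C ∧ q ∈ C ∧ (G.Adj a p ∨ G.Adj a q) := by
  have hmem : ∀ c ∈ C, c = a ∨ c = b ∨ c = p ∨ c = q := fun c hc => by simpa using hsub hc
  have hcl : ∀ c ∈ C, ∃ d ∈ C, ∃ e ∈ C, d ≠ e ∧ d ≠ c ∧ e ≠ c ∧ G.Adj c d ∧ G.Adj c e := by
    intro c hc
    obtain ⟨d, hd, e, he, hde, h1, h2⟩ := hC.2 c hc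
    exact ⟨d, hd, e, he, hde, h1.ne', h2.ne', h1, h2⟩
  obtain ⟨c, hc⟩ := hC.1
  obtain ⟨d, hd, e, he, hde, hdc, hec, -, -⟩ := hcl c hc
  have hc' := hmem c hc
  have hd' := hmem d hd
  have he' := hmem e he
  have haC : a ∈ C := by
    by_contra haC
    have hbC : b ∈ C := by clear hcl hmem hb hp hq; grind
    clear hc' hd' he'
    obtain ⟨d, hd, e, he, hde, hdc, hec, h1, h2⟩ := hcl b hbC
    have := hmem d hd
    have := hmem e he
    clear hcl hmem
    grind
  have hpC : p ∈ C := by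
    by_contra hpC
    have hqC : q ∈ C := by clear hcl hmem hb hp hq; grind
    clear hc' hd' he'
    obtain ⟨d, hd, e, he, hde, hdc, hec, h1, h2⟩ := hcl q hqC
    have := hmem d hd
    have := hmem e he
    clear hcl hmem
    grind
  have hqC : q ∈ C := by
    by_contra hqC
    clear hc' hd' he'
    obtain ⟨d, hd, e, he, hde, hdc, hec, h1, h2⟩ := hcl p hpC
    have := hmem d hd
    have := hmem e he
    clear hcl hmem
    grind
  refine ⟨hpC, hqC, ?_⟩
  clear hc' hd' he'
  obtain ⟨d, hd, e, he, hde, hdc, hec, h1, h2⟩ := hcl a haC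
  have := hmem d hd
  have := hmem e he
  clear hcl hmem
  grind

lemma BoundBelow.of_two_triangles {S R D : Finset V} (ih : BoundBelow G S)
    {v a b x y p q : V}
    (hn : [v, a, b, x, y, p, q].Nodup)
    (hsub : ∀ w ∈ ({v, a, b, x, y, p, q} : Finset V), w ∈ S)
    (hcover : ∀ w ∈ S, w ∈ ({v, a, b, x, y, p, q} : Finset V) ∨ w ∈ R)
    (hRS : R ⊆ S) (hRt : triComps G R = ∅)
    (hRadj : ∀ r ∈ R, ∀ w ∈ ({v, a, b, y, p, q} : Finset V), ¬ G.Adj w r)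
    (hdeg : ∀ w ∈ S, (nbhd G S w).card ≤ 4)
    (hva : G.Adj v a) (hvb : G.Adj v b) (hab : G.Adj a b) (hvx : G.Adj v x) (hxy : G.Adj x y)
    (hyp : G.Adj y p) (hyq : G.Adj y q) (hpq : G.Adj p q)
    (hcard : R.card + 4 ≤ S.card) (hDc : 4 * D.card ≤ R.card) (hD : Isolates G R D) :
    ∃ E : Finset V, 4 * E.card ≤ S.card ∧ Isolates G S E := by
  by_cases hcore : ∃ C ⊆ ({a, b, p, q} : Finset V), IsCore G C ∧ ∀ c ∈ C, ¬ G.Adj x c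
  · obtain ⟨C, hC, hCc, hCx⟩ := hcore
    have hn' := hn
    have hs := hsub
    simp only [List.nodup_cons, List.mem_cons, List.not_mem_nil, or_false, not_or,
      not_false_eq_true, List.nodup_nil, and_true] at hn'
    simp only [mem_insert, mem_singleton, forall_eq_or_imp, forall_eq] at hs
    obtain ⟨hv, ha, hb, hx, hy, hp, hq⟩ := hs
    have hb' : ¬ (G.Adj b p ∧ G.Adj b q) := by
      rintro ⟨h1, h2⟩
      have := card_nbhd_ge_five hb hv ha hp hq hvb.symm hab.symm h1 h2 (by simp [hn'])
      have := hdeg b hb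
      omega
    have hp' : ¬ (G.Adj p a ∧ G.Adj p b) := by
      rintro ⟨h1, h2⟩
      have := card_nbhd_ge_five hp ha hb hy hq h1 h2 hyp.symm hpq (by simp [hn'])
      have := hdeg p hp
      omega
    have hq' : ¬ (G.Adj q a ∧ G.Adj q b) := by
      rintro ⟨h1, h2⟩
      have := card_nbhd_ge_five hq ha hb hy hp h1 h2 hyq.symm hpq.symm (by simp [hn'])
      have := hdeg q hq
      omega
    obtain ⟨hpC, hqC, hapq⟩ := hCc.of_subset_four hC hb' hp' hq'
    rcases hapq with h | h
    · exact ih.of_adj_between_triangles hn hsub hcover hRS hRt hRadj hdeg hva hvb hab hxy hyp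
        hyq h (hCx q hqC)
    · have hset : ({v, a, b, x, y, q, p} : Finset V) = {v, a, b, x, y, p, q} := by
        rw [Finset.pair_comm q p]
      have hset' : ({v, a, b, y, q, p} : Finset V) = {v, a, b, y, p, q} := by
        rw [Finset.pair_comm q p]
      exact ih.of_adj_between_triangles (p := q) (q := p) (by simp [hn', Ne.symm hn'.2.2.2.2.2])
        (hset ▸ hsub) (hset ▸ hcover) hRS hRt (hset' ▸ hRadj) hdeg hva hvb hab hxy hyq
        hyp h (hCx p hpC)
  · push Not at hcore
    refine ⟨insert x D, by have := card_insert_le x D; omega,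
      Isolates.of_sdiff_nbhd (mem_insert_self x D) ?_⟩
    have hx : x ∈ S := hsub x (by simp)
    have hcl : IsClosedIn G (R \ nbhd G S x) (S \ nbhd G S x) := by
      refine ⟨sdiff_subset_sdiff hRS subset_rfl, fun c hc d hd hcd => ?_⟩
      rw [mem_sdiff] at hc hd ⊢
      refine ⟨?_, hd.2⟩
      rcases hcover d hd.1 with h | h
      · exfalso
        by_cases hdx : d = x
        · exact hd.2 (mem_nbhd.2 ⟨hd.1, Or.inl hdx⟩)
        · exact hRadj c hc.1 d (by simp only [mem_insert, mem_singleton] at h ⊢; grind) hcd.symm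
      · exact h
    have := Isolates.union (E := D) hcl ((hD.anti sdiff_subset).mono (subset_insert x D)) ?_
    · rwa [union_eq_left.2 (subset_insert x D)] at this
    · intro C hCS hC
      have hCmem : ∀ c ∈ C, c ∈ S ∧ ¬ (c = x ∨ G.Adj x c) ∧ c ∉ R := by
        intro c hc
        have := hCS hc
        simp only [mem_sdiff, mem_nbhd] at this
        tauto
      obtain ⟨c, hc, hxc⟩ := hcore C (fun c hc => by
        obtain ⟨h1, h2, h3⟩ := hCmem c hc
        have h4 := hcover c h1
        have : c ≠ v := by rintro rfl; exact h2 (Or.inr hvx.symm)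
        have : c ≠ y := by rintro rfl; exact h2 (Or.inr hxy)
        simp only [mem_insert, mem_singleton] at h4 ⊢
        grind) hC
      exact absurd (Or.inr hxc) (hCmem c hc).2.1

lemma BoundBelow.of_once_linked {S T D : Finset V} (ih : BoundBelow G S) (hS : IsConn G S)
    {v : V} (hv : v ∈ S) (h4 : 4 ≤ (nbhd G S v).card)
    (hmax : ∀ w ∈ S, (nbhd G S w).card ≤ (nbhd G S v).card)
    (hT : T ∈ triComps G (S \ nbhd G S v))
    (honce : ∀ x ∈ S, G.Adj v x → ∀ T₁ ∈ triComps G (S \ nbhd G S v),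
      ∀ T₂ ∈ triComps G (S \ nbhd G S v), (∃ t ∈ T₁, G.Adj x t) → (∃ t ∈ T₂, G.Adj x t) →
      T₁ = T₂)
    (hDc : 4 * D.card ≤ (nonTri G (S \ nbhd G S v)).card)
    (hD : Isolates G (nonTri G (S \ nbhd G S v)) D) :
    ∃ E : Finset V, 4 * E.card ≤ S.card ∧ Isolates G S E := by
  obtain ⟨x, hxS, hvx, y, hyT, hxy⟩ := hS.exists_adj hv hT
  have hT' := mem_triComps.1 hT
  have hTS : T ⊆ S := hT'.2.1.trans sdiff_subset
  have hyS : y ∈ S := hTS hyT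
  have hxT : x ∉ T := fun h =>
    (mem_sdiff.1 (hT'.2.1 h)).2 (mem_nbhd.2 ⟨hxS, Or.inr hvx⟩)
  have hTN : T ⊆ nbhd G S y := fun t ht => by
    rw [mem_nbhd]
    by_cases hty : t = y
    · exact ⟨hTS ht, Or.inl hty⟩
    · exact ⟨hTS ht, Or.inr (hT'.1.1 hyT ht (Ne.symm hty))⟩
  have hxN : x ∈ nbhd G S y := mem_nbhd.2 ⟨hxS, Or.inr hxy.symm⟩
  by_cases hE : triComps G (S \ nbhd G S y) = ∅
  · refine ih.of_vertex hyS ?_ hE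
    have h1 : (insert x T).card = 4 := by rw [card_insert_of_notMem hxT, hT'.1.2]
    exact h1 ▸ card_le_card (insert_subset hxN hTN)
  obtain ⟨U, hU⟩ := nonempty_iff_ne_empty.2 hE
  have hU' := mem_triComps.1 hU
  have hUS : U ⊆ S := hU'.2.1.trans sdiff_subset
  have hyv : y ∈ S \ nbhd G S v := hT'.2.1 hyT
  have hvy : v ∈ S \ nbhd G S y := by
    simp only [mem_sdiff, mem_nbhd] at hyv ⊢
    refine ⟨hv, fun h => hyv.2 ⟨hyS, h.2.imp Eq.symm SimpleGraph.Adj.symm⟩⟩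
  -- a vertex outside `N[v]` and in `N[y]` lies in `T`
  have hNT : ∀ w ∈ S \ nbhd G S v, w ∈ nbhd G S y → w ∈ T := by
    intro w hw hwy
    rcases (mem_nbhd.1 hwy).2 with rfl | h
    · exact hyT
    · exact hT'.2.2 y hyT w hw h
  have hvU : v ∈ U := by
    by_contra hvU
    have hUv : U ⊆ S \ nbhd G S v := by
      intro w hw
      refine mem_sdiff.2 ⟨hUS hw, fun h => ?_⟩
      rcases (mem_nbhd.1 h).2 with rfl | h
      · exact hvU hw
      · exact hvU (hU'.2.2 w hw v hvy h.symm)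
    have hUT : ∀ w ∈ U, w ∉ T := fun w hw hwT => (mem_sdiff.1 (hU'.2.1 hw)).2 (hTN hwT)
    have hUt : U ∈ triComps G (S \ nbhd G S v) := by
      refine mem_triComps.2 ⟨hU'.1, hUv, fun c hc d hd hcd => ?_⟩
      refine hU'.2.2 c hc d (mem_sdiff.2 ⟨(mem_sdiff.1 hd).1, fun h => ?_⟩) hcd
      exact hUT c hc (hT'.2.2 d (hNT d hd h) c (hUv hc) hcd.symm)
    obtain ⟨z, hzS, hvz, t, htU, hzt⟩ := hS.exists_adj hv hUt
    have hzU : z ∉ U := fun h =>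
      (mem_sdiff.1 (hUv h)).2 (mem_nbhd.2 ⟨hzS, Or.inr hvz⟩)
    have hzy : z ∈ nbhd G S y := by
      by_contra h
      exact hzU (hU'.2.2 t htU z (mem_sdiff.2 ⟨hzS, h⟩) hzt.symm)
    have hzy' : G.Adj y z := by
      rcases (mem_nbhd.1 hzy).2 with rfl | h
      · exact absurd (mem_nbhd.2 ⟨hzS, Or.inr hvz⟩) (mem_sdiff.1 hyv).2
      · exact h
    have := honce z hzS hvz T hT U hUt ⟨y, hyT, hzy'.symm⟩ ⟨t, htU, hzt⟩
    exact hUT t htU (this ▸ htU)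
  have hUN : U ⊆ nbhd G S v := by
    intro w hw
    rw [mem_nbhd]
    by_cases hwv : w = v
    · exact ⟨hUS hw, Or.inl hwv⟩
    · exact ⟨hUS hw, Or.inr (hU'.1.1 hvU hw (Ne.symm hwv))⟩
  -- `U` is not linked to anything outside `N[v] ∪ T`
  have hUout : ∀ w ∈ S \ nbhd G S v, w ∉ T → ∀ u ∈ U, ¬ G.Adj u w := by
    intro w hw hwT u hu huw
    have hwy : w ∉ nbhd G S y := fun h => hwT (hNT w hw h)
    exact (mem_sdiff.1 hw).2 (hUN (hU'.2.2 u hu w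
      (mem_sdiff.2 ⟨(mem_sdiff.1 hw).1, hwy⟩) huw))
  have honly : triComps G (S \ nbhd G S v) = {T} := by
    refine eq_singleton_iff_unique_mem.2 ⟨hT, fun T₃ hT₃ => ?_⟩
    by_contra hne
    obtain ⟨z, hzS, hvz, t, ht, hzt⟩ := hS.exists_adj hv hT₃
    have htT : t ∉ T := fun h => hne (eq_of_mem_triComps hT₃ hT ht h)
    have htv := (mem_triComps.1 hT₃).2.1 ht
    by_cases hzU : z ∈ U
    · exact hUout t htv htT z hzU hzt
    · have hzy : z ∈ nbhd G S y := by
        by_contra h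
        exact hzU (hU'.2.2 v hvU z (mem_sdiff.2 ⟨hzS, h⟩) hvz)
      rcases (mem_nbhd.1 hzy).2 with rfl | h
      · exact (mem_sdiff.1 hyv).2 (mem_nbhd.2 ⟨hzS, Or.inr hvz⟩)
      · exact hne (honce z hzS hvz T₃ hT₃ T hT ⟨t, ht, hzt⟩ ⟨y, hyT, h.symm⟩)
  set R := nonTri G (S \ nbhd G S v) with hR
  have hc1 := card_sdiff_add_card_eq_card (nbhd_subset (G := G) S v)
  have hc2 := card_eq_nonTri_add (G := G) (S \ nbhd G S v)
  rw [honly, card_singleton, ← hR] at hc2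
  by_cases h5 : 5 ≤ (nbhd G S v).card
  · refine ⟨insert v (insert y D), ?_, Isolates.of_sdiff_nbhd (mem_insert_self _ _)
      (Isolates.of_nonTri (hD.mono fun d hd => by simp [hd]) fun T₃ hT₃ => ?_)⟩
    · have h1 := card_insert_le v (insert y D)
      have h2 := card_insert_le y D
      omega
    · rw [honly, mem_singleton] at hT₃
      exact ⟨y, hT₃ ▸ hyT, y, by simp, Or.inl rfl⟩
  have hxU : x ∉ U := fun h => (mem_sdiff.1 (hU'.2.1 h)).2 hxN
  obtain ⟨a, b, hab', hUab⟩ := card_eq_two.1 (by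
    rw [card_erase_of_mem hvU, hU'.1.2] : (U.erase v).card = 2)
  obtain ⟨p, q, hpq', hTpq⟩ := card_eq_two.1 (by
    rw [card_erase_of_mem hyT, hT'.1.2] : (T.erase y).card = 2)
  have hUeq : U = {v, a, b} := by rw [← hUab, insert_erase hvU]
  have hTeq : T = {y, p, q} := by rw [← hTpq, insert_erase hyT]
  have hav : a ≠ v ∧ a ∈ U := mem_erase.1 (by rw [hUab]; simp)
  have hbv : b ≠ v ∧ b ∈ U := mem_erase.1 (by rw [hUab]; simp)
  have hpy : p ≠ y ∧ p ∈ T := mem_erase.1 (by rw [hTpq]; simp)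
  have hqy : q ≠ y ∧ q ∈ T := mem_erase.1 (by rw [hTpq]; simp)
  have hNeq : nbhd G S v = insert x U := by
    refine (eq_of_subset_of_card_le (insert_subset (mem_nbhd.2 ⟨hxS, Or.inr hvx⟩) hUN) ?_).symm
    rw [card_insert_of_notMem hxU, hU'.1.2]
    omega
  have hUT : ∀ u ∈ U, ∀ t ∈ T, u ≠ t := by
    rintro u hu t ht rfl
    exact (mem_sdiff.1 (hT'.2.1 ht)).2 (hUN hu)
  have hxt : ∀ t ∈ T, x ≠ t := fun t ht h => hxT (h ▸ ht)
  have hux : ∀ u ∈ U, u ≠ x := fun u hu h => hxU (h ▸ hu)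
  have h7 : ∀ w, w ∈ ({v, a, b, x, y, p, q} : Finset V) ↔ w = x ∨ w ∈ U ∨ w ∈ T := by
    intro w
    rw [hUeq, hTeq]
    simp only [mem_insert, mem_singleton]
    clear * -
    grind
  have h6 : ∀ w, w ∈ ({v, a, b, y, p, q} : Finset V) ↔ w ∈ U ∨ w ∈ T := by
    intro w
    rw [hUeq, hTeq]
    simp only [mem_insert, mem_singleton]
    clear * -
    grind
  have hRmem : ∀ r, r ∈ R ↔ r ∈ S \ nbhd G S v ∧ r ∉ T := by
    intro r
    rw [hR, mem_nonTri, honly]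
    simp
  refine ih.of_two_triangles (R := R) (D := D) (v := v) (a := a) (b := b) (x := x) (y := y)
    (p := p) (q := q) ?_ ?_ ?_ ?_ (triComps_nonTri _) ?_ ?_
    (hU'.1.1 hvU hav.2 hav.1.symm) (hU'.1.1 hvU hbv.2 hbv.1.symm) (hU'.1.1 hav.2 hbv.2 hab')
    hvx hxy (hT'.1.1 hyT hpy.2 hpy.1.symm) (hT'.1.1 hyT hqy.2 hqy.1.symm)
    (hT'.1.1 hpy.2 hqy.2 hpq') (by omega) hDc hD
  · simp [hUT _ hvU _ hyT, hUT _ hvU _ hpy.2, hUT _ hvU _ hqy.2, hUT _ hav.2 _ hyT,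
      hUT _ hav.2 _ hpy.2, hUT _ hav.2 _ hqy.2, hUT _ hbv.2 _ hyT, hUT _ hbv.2 _ hpy.2,
      hUT _ hbv.2 _ hqy.2, hux _ hvU, hux _ hav.2, hux _ hbv.2, hxt _ hyT, hxt _ hpy.2,
      hxt _ hqy.2, hav.1.symm, hbv.1.symm, hpy.1.symm, hqy.1.symm, hab', hpq']
  · intro w hw
    rcases (h7 w).1 hw with rfl | h | h
    exacts [hxS, hUS h, hTS h]
  · intro w hw
    by_cases hwT : w ∈ T
    · exact Or.inl ((h7 w).2 (Or.inr (Or.inr hwT)))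
    by_cases hwv : w ∈ nbhd G S v
    · rw [hNeq, mem_insert] at hwv
      exact Or.inl ((h7 w).2 (hwv.imp_right Or.inl))
    · exact Or.inr ((hRmem w).2 ⟨mem_sdiff.2 ⟨hw, hwv⟩, hwT⟩)
  · exact fun r hr => (mem_sdiff.1 ((hRmem r).1 hr).1).1
  · intro r hr w hw hwr
    obtain ⟨hr1, hr2⟩ := (hRmem r).1 hr
    rcases (h6 w).1 hw with h | h
    · exact hUout r hr1 hr2 w h hwr
    · exact hr2 (hT'.2.2 w h r hr1 hwr)
  · intro w hw
    have := hmax w hw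
    omega

lemma BoundBelow.of_isConn {S : Finset V} (ih : BoundBelow G S) (hS : IsConn G S)
    (ht : triComps G S = ∅) (hne : S.Nonempty) :
    ∃ D : Finset V, 4 * D.card ≤ S.card ∧ Isolates G S D := by
  by_cases h4 : 4 ≤ S.card
  swap
  · refine ⟨∅, by simp, fun C hCS hC => ?_⟩
    have h3 := hC.three_le_card
    have hCeq : C = S := eq_of_subset_of_card_le hCS (by omega)
    subst hCeq
    have : C ∈ triComps G C := mem_triComps.2
      ⟨hC.isNClique (by omega), subset_rfl, fun _ _ _ hb _ => hb⟩
    simp [ht] at this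
  obtain ⟨v, hv, hmax⟩ := exists_max_image S (fun w => (nbhd G S w).card) hne
  by_cases hk : 4 ≤ (nbhd G S v).card
  swap
  · refine ⟨{v}, by simpa using h4, fun C hCS hC => ?_⟩
    have hCeq : C = S := by
      refine hS C hC.1 ⟨hCS, fun c hc d hd hcd => ?_⟩
      obtain ⟨e, f, he, hf, -, hsub, h3⟩ := hC.exists_three hc
      have hN : ({c, e, f} : Finset V) = nbhd G S c := by
        refine eq_of_subset_of_card_le (fun w hw => mem_nbhd.2 ⟨hCS (hsub hw), ?_⟩) ?_
        · simp only [mem_insert, mem_singleton] at hw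
          rcases hw with rfl | rfl | rfl
          exacts [Or.inl rfl, Or.inr he, Or.inr hf]
        · have := hmax c (hCS hc)
          omega
      exact hsub (hN ▸ mem_nbhd.2 ⟨hd, Or.inr hcd⟩)
    exact ⟨v, hCeq ▸ hv, v, mem_singleton_self v, Or.inl rfl⟩
  have hss : nonTri G (S \ nbhd G S v) ⊂ S := by
    refine (isClosedIn_nonTri _).1.trans_ssubset ?_
    exact sdiff_ssubset (nbhd_subset S v) ⟨v, mem_nbhd.2 ⟨hv, Or.inl rfl⟩⟩
  obtain ⟨D, hDc, hD⟩ := ih _ hss (triComps_nonTri _)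
  by_cases hT : triComps G (S \ nbhd G S v) = ∅
  · exact ih.of_vertex hv hk hT
  obtain ⟨T, hT⟩ := nonempty_iff_ne_empty.2 hT
  by_cases honce : ∀ x ∈ S, G.Adj v x → ∀ T₁ ∈ triComps G (S \ nbhd G S v),
      ∀ T₂ ∈ triComps G (S \ nbhd G S v), (∃ t ∈ T₁, G.Adj x t) → (∃ t ∈ T₂, G.Adj x t) →
      T₁ = T₂
  · exact ih.of_once_linked hS hv hk hmax hT honce hDc hD
  · simp only [not_forall] at honce
    obtain ⟨x, hx, hvx, T₁, hT₁, T₂, hT₂, h₁, h₂, hne⟩ := honce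
    exact exists_isolates_of_two_linked hS hv hx hvx hT₁ hT₂ hne h₁ h₂ hD hDc

variable (G) in
theorem exists_isolates (S : Finset V) (ht : triComps G S = ∅) :
    ∃ D : Finset V, 4 * D.card ≤ S.card ∧ Isolates G S D := by
  induction S using Finset.strongInduction with
  | H S ih =>
    rcases S.eq_empty_or_nonempty with rfl | hne
    · exact ⟨∅, by simp, fun C hC hCc => absurd hCc.1 (by simp [subset_empty.1 hC])⟩
    by_cases hS : IsConn G S
    · exact BoundBelow.of_isConn (fun U hU h => ih U hU h) hS ht hne
    · simp only [IsConn, not_forall] at hS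
      obtain ⟨A, hA, hAS, hAne⟩ := hS
      have hsub : ∀ B, IsClosedIn G B S → triComps G B = ∅ := by
        refine fun B hB => eq_empty_of_forall_notMem fun T hT => ?_
        have hT' := mem_triComps.1 hT
        have : T ∈ triComps G S := mem_triComps.2 ⟨hT'.1, hT'.2.trans hB⟩
        simp [ht] at this
      obtain ⟨D, hDc, hD⟩ := ih A (hAS.1.ssubset_of_ne hAne) (hsub A hAS)
      obtain ⟨E, hEc, hE⟩ := ih (S \ A) (sdiff_ssubset hAS.1 hA) (hsub _ hAS.sdiff)
      refine ⟨D ∪ E, ?_, hD.union hAS hE⟩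
      have := card_union_le D E
      have := card_sdiff_add_card_eq_card hAS.1
      omega

lemma isCore_image_cycle {n : ℕ} (f : Fin (n + 3) → V) (hf : Function.Injective f)
    (hadj : ∀ i j, (cycleGraph (n + 3)).Adj i j → G.Adj (f i) (f j)) :
    IsCore G (univ.image f) := by
  refine ⟨⟨f 0, mem_image_of_mem f (mem_univ 0)⟩, fun v hv => ?_⟩
  obtain ⟨i, -, rfl⟩ := mem_image.1 hv
  refine ⟨f (i + 1), mem_image_of_mem f (mem_univ _), f (i - 1),
    mem_image_of_mem f (mem_univ _), fun h => ?_, hadj _ _ ?_, hadj _ _ ?_⟩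
  · have h1 : i + 1 = i - 1 := hf h
    have h2 : (1 : Fin (n + 3)) + 1 = 0 := by
      have h3 := congrArg (fun t => t - i + 1) h1
      simpa using h3
    have h3 := congrArg Fin.val h2
    rw [Fin.val_add] at h3
    simp [Nat.mod_eq_of_lt (show 2 < n + 3 by omega)] at h3
  · rw [cycleGraph_adj]; simp
  · rw [cycleGraph_adj]; simp

lemma nonempty_iso_cycleGraph_three [Fintype V] (h3 : G.IsNClique 3 univ) :
    Nonempty (G ≃g cycleGraph 3) := by
  have hG : G = ⊤ := by
    ext a b
    exact ⟨fun h => h.ne, fun h => h3.1 (mem_univ a) (mem_univ b) h⟩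
  have hc : Fintype.card V = 3 := h3.2
  rw [hG, cycleGraph_three_eq_top]
  exact ⟨Iso.completeGraph (Fintype.equivFinOfCardEq hc)⟩

lemma IsClosedIn.eq_univ [Fintype V] (hG : G.Connected) {T : Finset V}
    (hT : IsClosedIn G T univ) (hne : T.Nonempty) : T = univ := by
  obtain ⟨t, ht⟩ := hne
  refine eq_univ_iff_forall.2 fun w => ?_
  obtain ⟨p⟩ := hG.preconnected t w
  induction p with
  | nil => exact ht
  | cons h _ ih => exact ih (hT.2 _ ht _ (mem_univ _) h)

end CycleIsolation

/-- If `G` is a connected graph with exactly `n` vertices and `G` is not a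
triangle, then `ι(G, 𝓒) ≤ n/4`, where `𝓒` is the set of all cycles. -/
theorem isolation_cycles_le_card_div_four {V : Type*} [Fintype V] (G : SimpleGraph V) (n : ℕ)
    (hn : Fintype.card V = n) (hconn : G.Connected)
    (hC3 : ¬ Nonempty (G ≃g cycleGraph 3)) :
    (iotaCycGE 3 G : ℝ) ≤ n / 4 := by
  classical
  have ht : CycleIsolation.triComps G Finset.univ = ∅ := by
    refine Finset.eq_empty_of_forall_notMem fun T hT => hC3 ?_
    obtain ⟨h3, hcl⟩ := CycleIsolation.mem_triComps.1 hT
    have := hcl.eq_univ hconn (Finset.card_pos.1 (by rw [h3.2]; norm_num))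
    exact CycleIsolation.nonempty_iso_cycleGraph_three (this ▸ h3)
  obtain ⟨D, hDc, hD⟩ := CycleIsolation.exists_isolates G Finset.univ ht
  have hiso : IsCycIsolatingGE 3 G (D : Set V) := by
    rintro m hm ⟨f, hf⟩
    obtain ⟨k, rfl⟩ := Nat.exists_eq_add_of_le' hm
    have hcore := CycleIsolation.isCore_image_cycle (G := G) (fun i => (f i : V))
      (Subtype.val_injective.comp hf) fun i j hij => f.map_rel hij
    obtain ⟨c, hc, d, hd, hdc⟩ := hD _ (Finset.subset_univ _) hcore
    obtain ⟨i, -, rfl⟩ := Finset.mem_image.1 hc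
    refine (f i).2 ?_
    rcases hdc with rfl | h
    · exact Or.inl hd
    · exact Or.inr ⟨d, hd, h⟩
  have hle : iotaCycGE 3 G ≤ D.card := Nat.sInf_le ⟨D, Set.ncard_coe_finset D, hiso⟩
  rw [Finset.card_univ, hn] at hDc
  rw [le_div_iff₀ (by norm_num)]
  have : iotaCycGE 3 G * 4 ≤ n := by omega
  exact_mod_cast this
end

section
/- Let G be a graph, let 𝓕 be a set of graphs, let X be a subset of V(G), and let Y be a subset of the closed neighbourhood N[X] of X in G. Then ι(G, 𝓕) ≤ |X| + ι(G − Y, 𝓕), where G − Y is the graph obtained from G by deleting the vertices in Y. -/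
open SimpleGraph

/-- `D` is an `𝓕`-isolating set of `G`, where `𝓕` is the (indexed) set of graphs `F i` :
the graph `G − N[D]` contains no copy of any `F i`. -/
def IsIsolating {V ι : Type*} {W : ι → Type*} (F : ∀ i, SimpleGraph (W i))
    (G : SimpleGraph V) (D : Set V) : Prop :=
  ∀ i, ¬ HasCopy (F i) (G.induce (closedNbhd G D)ᶜ)

/-- The `𝓕`-isolation number of `G` : the least cardinality of an `𝓕`-isolating set. -/
noncomputable def iota {V ι : Type*} {W : ι → Type*} (F : ∀ i, SimpleGraph (W i))
    (G : SimpleGraph V) : ℕ :=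
  sInf {r | ∃ D : Set V, D.ncard = r ∧ IsIsolating F G D}

/-- The set of all vertices is isolating, provided that every forbidden graph is nonempty. -/
theorem isIsolating_univ {V ι : Type*} {W : ι → Type*} [∀ i, Nonempty (W i)]
    (F : ∀ i, SimpleGraph (W i)) (G : SimpleGraph V) : IsIsolating F G Set.univ := by
  rintro i ⟨f, -⟩
  exact (f (Classical.arbitrary (W i))).2 (Or.inl trivial)

/-- If `Y ⊆ N[X]` and `D` isolates `G − Y`, then `X ∪ D` isolates `G`. -/
theorem IsIsolating.union_image_val {V ι : Type*} {W : ι → Type*}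
    {F : ∀ i, SimpleGraph (W i)} {G : SimpleGraph V} {X Y : Set V}
    (hY : Y ⊆ closedNbhd G X) {D : Set ↥Yᶜ} (hD : IsIsolating F (G.induce Yᶜ) D) :
    IsIsolating F G (X ∪ Subtype.val '' D) := by
  rintro i ⟨f, hf⟩
  have hfY (w : W i) : (f w : V) ∈ Yᶜ := fun hw ↦ (f w).2 <| by
    rcases hY hw with hX | ⟨u, hu, huw⟩
    · exact Or.inl (Or.inl hX)
    · exact Or.inr ⟨u, Or.inl hu, huw⟩
  have hfD (w : W i) : (⟨f w, hfY w⟩ : ↥Yᶜ) ∈ (closedNbhd (G.induce Yᶜ) D)ᶜ :=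
    fun hw ↦ (f w).2 <| by
      rcases hw with hw | ⟨u, hu, huw⟩
      · exact Or.inl (Or.inr ⟨_, hw, rfl⟩)
      · exact Or.inr ⟨u, Or.inr ⟨u, hu, rfl⟩, huw⟩
  refine hD i ⟨⟨fun w ↦ ⟨⟨f w, hfY w⟩, hfD w⟩, fun {a b} hab ↦ f.map_adj hab⟩, ?_⟩
  intro a b hab
  apply hf
  apply Subtype.ext
  exact congrArg (fun x ↦ (x.1 : V)) hab

/-- For any graph `G`, any set `𝓕` of graphs, any `X ⊆ V(G)` and any
`Y ⊆ N[X]`, we have `ι(G, 𝓕) ≤ |X| + ι(G − Y, 𝓕)`. -/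
theorem isolation_le_of_delete_closedNbhd_subset {V ι : Type*} [Fintype V] {W : ι → Type*}
    [∀ i, Nonempty (W i)] (F : ∀ i, SimpleGraph (W i)) (G : SimpleGraph V)
    (X Y : Set V) (hY : Y ⊆ closedNbhd G X) :
    iota F G ≤ X.ncard + iota F (G.induce Yᶜ) := by
  obtain ⟨D, hDcard, hD⟩ := Nat.sInf_mem
    (s := {r | ∃ D : Set ↥Yᶜ, D.ncard = r ∧ IsIsolating F (G.induce Yᶜ) D})
    ⟨_, Set.univ, rfl, isIsolating_univ F _⟩
  calc iota F G ≤ (X ∪ Subtype.val '' D).ncard :=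
        Nat.sInf_le ⟨_, rfl, hD.union_image_val hY⟩
    _ ≤ X.ncard + (Subtype.val '' D).ncard := Set.ncard_union_le _ _
    _ = X.ncard + iota F (G.induce Yᶜ) := by
        rw [Set.ncard_image_of_injective _ Subtype.val_injective, hDcard, iota]
end

section
/- Let G be a graph, let 𝓕 be a set of cycles, let x be a vertex of G, and let Y be a subset of V(G) \ {x} such that N[Y] ∩ V(G − Y) ⊆ {x} and the subgraph of G induced by {x} ∪ Y contains no subgraph isomorphic to a member of 𝓕. Then ι(G, 𝓕) = ι(G − Y, 𝓕), and moreover every 𝓕-isolating set of G − Y is an 𝓕-isolating set of G. -/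
open SimpleGraph

/-- `D` is an isolating set of `G` with respect to the set of cycles `{C_n : n ∈ S}` :
the graph `G − N[D]` contains no copy of `C_n` for any `n ∈ S`. -/
def IsCycSetIsolating {V : Type*} (S : Set ℕ) (G : SimpleGraph V) (D : Set V) : Prop :=
  ∀ n ∈ S, ¬ HasCopy (cycleGraph n) (G.induce (closedNbhd G D)ᶜ)

/-- The isolation number of `G` with respect to the set of cycles `{C_n : n ∈ S}`. -/
noncomputable def iotaCycSet {V : Type*} (S : Set ℕ) (G : SimpleGraph V) : ℕ :=
  sInf {r | ∃ D : Set V, D.ncard = r ∧ IsCycSetIsolating S G D}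

/-- Containing a copy of `F` in an induced subgraph amounts to an injective homomorphism into the
whole graph with values in the inducing set. -/
theorem hasCopy_induce_iff {W V : Type*} {F : SimpleGraph W} {G : SimpleGraph V} {s : Set V} :
    HasCopy F (G.induce s) ↔ ∃ f : F →g G, Function.Injective f ∧ ∀ w, f w ∈ s := by
  constructor
  · rintro ⟨f, hf⟩
    exact ⟨(Embedding.induce s).toHom.comp f, Subtype.val_injective.comp hf, fun w ↦ (f w).2⟩
  · rintro ⟨f, hf, hs⟩
    exact ⟨⟨fun w ↦ ⟨f w, hs w⟩, fun h ↦ f.map_rel h⟩,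
      fun a b h ↦ hf (congrArg Subtype.val h)⟩

/-- Deleting one vertex `i` from a cycle leaves a connected graph: a predicate that is constant
along the edges avoiding `i` is constant off `i`. -/
theorem cycleGraph_pred_iff_of_ne {m : ℕ} {p : Fin (m + 3) → Prop} {i : Fin (m + 3)}
    (hp : ∀ a b, (cycleGraph (m + 3)).Adj a b → a ≠ i → b ≠ i → (p a ↔ p b))
    {a b : Fin (m + 3)} (ha : a ≠ i) (hb : b ≠ i) : p a ↔ p b := by
  have key : ∀ d : Fin (m + 3), d ≠ 0 → (p (i + d) ↔ p (i + 1)) := by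
    intro d
    induction d using Fin.induction with
    | zero => exact fun h ↦ absurd rfl h
    | succ e ih =>
      intro _
      rw [← Fin.coeSucc_eq_succ]
      by_cases h0 : e.castSucc = 0
      · rw [h0, zero_add]
      · rw [← ih h0]
        refine hp _ _ ?_ (by simp) (by simpa using h0)
        rw [cycleGraph_adj]
        left
        abel
  have hd : ∀ c, c ≠ i → (p c ↔ p (i + 1)) := fun c hc ↦ by
    simpa using key (c - i) (sub_ne_zero.mpr hc)
  rw [hd a ha, hd b hb]

/-- A cycle cannot cross a cut vertex: if `x` is the only vertex outside `Y` that may have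
neighbours in `Y`, then every cycle lies in `{x} ∪ Y` or avoids `Y`. -/
theorem cycleGraph_hom_mem_or_notMem {V : Type*} {G : SimpleGraph V} {x : V} {Y : Set V}
    (hxY : x ∉ Y) (hN : closedNbhd G Y ∩ Yᶜ ⊆ {x}) {n : ℕ} (hn : 3 ≤ n)
    (f : cycleGraph n →g G) (hf : Function.Injective f) :
    (∀ i, f i ∈ ({x} ∪ Y : Set V)) ∨ ∀ i, f i ∈ Yᶜ := by
  obtain ⟨m, rfl⟩ := Nat.exists_eq_add_of_le' hn
  by_contra! h
  obtain ⟨⟨b, hb⟩, a, ha⟩ := h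
  simp only [Set.mem_union, Set.mem_singleton_iff, not_or] at hb
  rw [Set.notMem_compl_iff] at ha
  obtain ⟨i, hia, hib, hi⟩ : ∃ i, a ≠ i ∧ b ≠ i ∧ ∀ j, j ≠ i → f j ≠ x := by
    by_cases hx : ∃ i, f i = x
    · obtain ⟨i, rfl⟩ := hx
      exact ⟨i, fun h ↦ hxY (h ▸ ha), fun h ↦ hb.1 (h ▸ rfl), fun j hj h ↦ hj (hf h)⟩
    · push Not at hx
      obtain ⟨i, hi⟩ := Finset.exists_mem_notMem_of_card_lt_card
        (s := ({a, b} : Finset (Fin (m + 3)))) (t := Finset.univ)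
        (Finset.card_le_two.trans_lt (by simp))
      simp only [Finset.mem_univ, Finset.mem_insert, Finset.mem_singleton, not_or, true_and] at hi
      exact ⟨i, Ne.symm hi.1, Ne.symm hi.2, fun j _ ↦ hx j⟩
  have hout : ∀ c d, (cycleGraph (m + 3)).Adj c d → d ≠ i → f c ∈ Y → f d ∈ Y := by
    intro c d hcd hd hc
    by_contra hdY
    exact hi d hd (hN ⟨Or.inr ⟨f c, hc, f.map_rel hcd⟩, hdY⟩)
  exact hb.2 ((cycleGraph_pred_iff_of_ne (p := fun j ↦ f j ∈ Y)
    (fun c d hcd hc hd ↦ ⟨hout c d hcd hd, hout d c hcd.symm hc⟩) hia hib).1 ha)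

/-- The isolation number is attained. -/
theorem exists_isCycSetIsolating_ncard_eq {V : Type*} (G : SimpleGraph V) {S : Set ℕ}
    (hS : ∀ n ∈ S, 3 ≤ n) : ∃ D : Set V, D.ncard = iotaCycSet S G ∧ IsCycSetIsolating S G D := by
  refine Nat.sInf_mem
    (s := {r | ∃ D : Set V, D.ncard = r ∧ IsCycSetIsolating S G D}) ⟨_, Set.univ, rfl, ?_⟩
  rintro n hn ⟨f, -⟩
  exact (f ⟨0, by have := hS n hn; omega⟩).2 (Or.inl trivial)

theorem iotaCycSet_le_ncard {V : Type*} {G : SimpleGraph V} {S : Set ℕ} {D : Set V}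
    (hD : IsCycSetIsolating S G D) : iotaCycSet S G ≤ D.ncard :=
  Nat.sInf_le ⟨D, rfl, hD⟩

/-- Isolating sets extend over `Y` when `Y` is attached at `x` only and `G[{x} ∪ Y]` contains none
of the cycles. -/
theorem IsCycSetIsolating.image_val {V : Type*} {G : SimpleGraph V} {S : Set ℕ}
    (hS : ∀ n ∈ S, 3 ≤ n) {x : V} {Y : Set V} (hxY : x ∉ Y) (hN : closedNbhd G Y ∩ Yᶜ ⊆ {x})
    (hno : ∀ n ∈ S, ¬ HasCopy (cycleGraph n) (G.induce ({x} ∪ Y))) {D : Set ↥(Yᶜ)}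
    (hD : IsCycSetIsolating S (G.induce Yᶜ) D) : IsCycSetIsolating S G (Subtype.val '' D) := by
  intro n hn hcopy
  obtain ⟨f, hf, hfD⟩ := hasCopy_induce_iff.1 hcopy
  rcases cycleGraph_hom_mem_or_notMem hxY hN (hS n hn) f hf with h | h
  · exact hno n hn (hasCopy_induce_iff.2 ⟨f, hf, h⟩)
  · refine hD n hn (hasCopy_induce_iff.2 ⟨⟨fun i ↦ ⟨f i, h i⟩, fun hij ↦ f.map_rel hij⟩,
      fun i j hij ↦ hf (congrArg Subtype.val hij), ?_⟩)
    rintro i (hi | ⟨u, hu, hui⟩)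
    · exact hfD i (Or.inl ⟨_, hi, rfl⟩)
    · exact hfD i (Or.inr ⟨u, ⟨u, hu, rfl⟩, hui⟩)

/-- Isolating sets restrict to `G − Y`, once `x` replaces the vertices lying in `Y`. -/
theorem IsCycSetIsolating.preimage_val {V : Type*} {G : SimpleGraph V} {S : Set ℕ} {x : V}
    {Y : Set V} (hN : closedNbhd G Y ∩ Yᶜ ⊆ {x}) {D E : Set V} (hD : IsCycSetIsolating S G D)
    (hDE : D \ Y ⊆ E) (hxE : (D ∩ Y).Nonempty → x ∈ E) :
    IsCycSetIsolating S (G.induce Yᶜ) (Subtype.val ⁻¹' E) := by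
  intro n hn hcopy
  obtain ⟨f, hf, hfE⟩ := hasCopy_induce_iff.1 hcopy
  refine hD n hn (hasCopy_induce_iff.2 ⟨(Embedding.induce Yᶜ).toHom.comp f,
    Subtype.val_injective.comp hf, ?_⟩)
  rintro i (hi | ⟨u, hu, hui⟩)
  · exact hfE i (Or.inl (hDE ⟨hi, (f i).2⟩))
  · by_cases huY : u ∈ Y
    · have hfx : (f i : V) = x := hN ⟨Or.inr ⟨u, huY, hui⟩, (f i).2⟩
      exact hfE i (Or.inl (by simpa [hfx] using hxE ⟨u, hu, huY⟩))
    · exact hfE i (Or.inr ⟨⟨u, huY⟩, hDE ⟨hu, huY⟩, hui⟩)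

/-- Let `G` be a graph, `𝓕 = {C_n : n ∈ S}` a set of cycles, `x ∈ V(G)` and
`Y ⊆ V(G) \ {x}` such that `N[Y] ∩ V(G − Y) ⊆ {x}` and `G[{x} ∪ Y]` contains no `𝓕`-graph.
Then `ι(G, 𝓕) = ι(G − Y, 𝓕)` and every `𝓕`-isolating set of `G − Y` is an `𝓕`-isolating set
of `G`. -/
theorem isolation_eq_of_pendant {V : Type*} [Fintype V] (G : SimpleGraph V)
    (S : Set ℕ) (hS : ∀ n ∈ S, 3 ≤ n) (x : V) (Y : Set V) (hxY : x ∉ Y)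
    (hN : closedNbhd G Y ∩ Yᶜ ⊆ {x})
    (hno : ∀ n ∈ S, ¬ HasCopy (cycleGraph n) (G.induce ({x} ∪ Y))) :
    iotaCycSet S G = iotaCycSet S (G.induce Yᶜ) ∧
      ∀ D : Set ↥(Yᶜ), IsCycSetIsolating S (G.induce Yᶜ) D →
        IsCycSetIsolating S G (Subtype.val '' D) := by
  refine ⟨le_antisymm ?_ ?_, fun D hD ↦ hD.image_val hS hxY hN hno⟩
  · obtain ⟨D, hcard, hD⟩ := exists_isCycSetIsolating_ncard_eq (G.induce Yᶜ) hS
    rw [← hcard, ← Set.ncard_image_of_injective D Subtype.val_injective]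
    exact iotaCycSet_le_ncard (hD.image_val hS hxY hN hno)
  · obtain ⟨D, hcard, hD⟩ := exists_isCycSetIsolating_ncard_eq G hS
    obtain ⟨E, hEY, hED, hDE, hxE⟩ : ∃ E : Set V, E ⊆ Yᶜ ∧ E.ncard ≤ D.ncard ∧ D \ Y ⊆ E ∧
        ((D ∩ Y).Nonempty → x ∈ E) := by
      by_cases hDY : (D ∩ Y).Nonempty
      · obtain ⟨y, hyD, hyY⟩ := hDY
        refine ⟨insert x (D \ Y), Set.insert_subset hxY fun v hv ↦ hv.2, ?_,
          Set.subset_insert _ _, fun _ ↦ Set.mem_insert _ _⟩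
        have hlt : (D \ Y).ncard < D.ncard :=
          Set.ncard_lt_ncard ⟨Set.sdiff_subset, fun h ↦ (h hyD).2 hyY⟩
        exact (Set.ncard_insert_le _ _).trans hlt
      · exact ⟨D \ Y, fun v hv ↦ hv.2, Set.ncard_le_ncard Set.sdiff_subset, subset_rfl,
          fun h ↦ absurd h hDY⟩
    have hE : (Subtype.val ⁻¹' E : Set ↥(Yᶜ)).ncard = E.ncard :=
      Set.ncard_preimage_of_injective_subset_range Subtype.val_injective (by rwa [Subtype.range_coe])
    calc iotaCycSet S (G.induce Yᶜ) ≤ (Subtype.val ⁻¹' E : Set ↥(Yᶜ)).ncard :=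
          iotaCycSet_le_ncard (hD.preimage_val hN hDE hxE)
      _ = E.ncard := hE
      _ ≤ iotaCycSet S G := hcard ▸ hED
end

section
/- Let G be a graph, let 𝓕 be a set of cycles, and let Y ⊆ V(G) be such that the subgraph of G induced by Y contains no subgraph isomorphic to a member of 𝓕 and, for every connected component H of G − Y, there is at most one edge of G with one endpoint in V(H) and the other endpoint in Y. Then ι(G, 𝓕) ≤ ι(G − Y, 𝓕), and moreover every 𝓕-isolating set of G − Y is an 𝓕-isolating set of G. -/
open SimpleGraph

/-- The set of edges of `G` with one endpoint in `A` and the other endpoint in `B`. -/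
def edgesBetween {V : Type*} (G : SimpleGraph V) (A B : Set V) : Set (Sym2 V) :=
  {e | e ∈ G.edgeSet ∧ ∃ a ∈ A, ∃ b ∈ B, e = s(a, b)}

open scoped Fin.CommRing in
theorem Fin.forall_of_add_one {m : ℕ} {P : Fin (m + 1) → Prop} (h : ∀ j, P j → P (j + 1))
    {i : Fin (m + 1)} (hi : P i) (k : Fin (m + 1)) : P k := by
  have key : ∀ t : ℕ, P (i + (t : Fin (m + 1))) := by
    intro t
    induction t with
    | zero => simpa using hi
    | succ t ih =>
      have := h _ ih
      rwa [add_assoc, ← Nat.cast_succ] at this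
  have := key (k - i).val
  rwa [Fin.cast_val_eq_self, add_sub_cancel] at this

theorem closedNbhd_induce_subset {V : Type*} (G : SimpleGraph V) (A : Set V) (D : Set A) :
    closedNbhd (G.induce A) D ⊆ Subtype.val ⁻¹' closedNbhd G (Subtype.val '' D) := by
  rintro v (hv | ⟨u, hu, huv⟩)
  · exact Or.inl ⟨v, hv, rfl⟩
  · exact Or.inr ⟨u, ⟨u, hu, rfl⟩, huv⟩

/-- If each component of `G − Y` is joined to `Y` by at most one edge, then every cycle of `G`
lies inside `Y` or avoids `Y`. -/
theorem cycle_subset_or_disjoint {V : Type*} [Finite V] {G : SimpleGraph V} {Y : Set V}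
    (hcomp : ∀ H : (G.induce Yᶜ).ConnectedComponent,
      (edgesBetween G (Subtype.val '' H.supp) Y).ncard ≤ 1)
    {m : ℕ} (f : cycleGraph (m + 3) →g G) (hf : Function.Injective f) :
    (∀ i, f i ∈ Y) ∨ ∀ i, f i ∉ Y := by
  by_contra! hmix
  obtain ⟨⟨a, ha⟩, b, hb⟩ := hmix
  have hadj : ∀ i, G.Adj (f i) (f (i + 1)) := fun i =>
    f.map_rel (by simp [cycleGraph_adj])
  obtain ⟨j, hj, hj1⟩ : ∃ j, f j ∉ Y ∧ f (j + 1) ∈ Y := by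
    by_contra! h
    exact Fin.forall_of_add_one (P := fun i => f i ∉ Y) h ha b hb
  let H := (G.induce Yᶜ).connectedComponentMk ⟨f j, hj⟩
  have hjH : f j ∈ Subtype.val '' H.supp := ⟨⟨f j, hj⟩, rfl, rfl⟩
  have hHY : ∀ v ∈ Subtype.val '' H.supp, v ∉ Y := by
    rintro _ ⟨v, -, rfl⟩
    exact v.2
  obtain ⟨k, hk, hk1⟩ :
      ∃ k, f k ∉ Subtype.val '' H.supp ∧ f (k + 1) ∈ Subtype.val '' H.supp := by
    by_contra! h
    exact Fin.forall_of_add_one (P := fun i => f i ∉ Subtype.val '' H.supp) h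
      (fun hmem => hHY _ hmem hj1) j hjH
  have hkY : f k ∈ Y := by
    by_contra hkY
    obtain ⟨v, hv, hvk⟩ := hk1
    refine hk ⟨⟨f k, hkY⟩, ?_, rfl⟩
    have hvadj : (G.induce Yᶜ).Adj ⟨f k, hkY⟩ v := by
      simpa [hvk] using hadj k
    exact (ConnectedComponent.sound hvadj.reachable).trans hv
  have heq : s(f j, f (j + 1)) = s(f (k + 1), f k) :=
    (Set.ncard_le_one (Set.toFinite _)).1 (hcomp H) _ ⟨hadj j, _, hjH, _, hj1, rfl⟩
      _ ⟨(hadj k).symm, _, hk1, _, hkY, rfl⟩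
  rcases Sym2.eq_iff.1 heq with ⟨h1, h2⟩ | ⟨h1, -⟩
  · have h3 : k + 1 + 1 = k := by rw [← hf h1, hf h2]
    rw [add_assoc, add_eq_left] at h3
    simp only [Fin.ext_iff, Fin.val_add, Fin.val_one, Fin.val_zero] at h3
    rw [Nat.mod_eq_of_lt (by omega)] at h3
    omega
  · exact hj (h1 ▸ hkY)

theorem IsCycSetIsolating.of_induce_compl {V : Type*} [Finite V] {G : SimpleGraph V}
    {S : Set ℕ} (hS : ∀ n ∈ S, 3 ≤ n) {Y : Set V}
    (hY : ∀ n ∈ S, ¬ HasCopy (cycleGraph n) (G.induce Y))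
    (hcomp : ∀ H : (G.induce Yᶜ).ConnectedComponent,
      (edgesBetween G (Subtype.val '' H.supp) Y).ncard ≤ 1)
    {D : Set ↥(Yᶜ)} (hD : IsCycSetIsolating S (G.induce Yᶜ) D) :
    IsCycSetIsolating S G (Subtype.val '' D) := by
  rintro n hn ⟨f, hf⟩
  obtain ⟨m, rfl⟩ := Nat.exists_eq_add_of_le' (hS n hn)
  let g : cycleGraph (m + 3) →g G := (Embedding.induce _).toHom.comp f
  have hg : Function.Injective g := Subtype.val_injective.comp hf
  rcases cycle_subset_or_disjoint hcomp g hg with h | h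
  · exact hY _ hn ⟨⟨fun i => ⟨g i, h i⟩, fun hab => g.map_rel hab⟩,
      fun a b hab => hg (congrArg (fun x : Y => x.1) hab)⟩
  · exact hD _ hn ⟨⟨fun i => ⟨⟨g i, h i⟩, fun hi => (f i).2 (closedNbhd_induce_subset G _ D hi)⟩,
      fun hab => g.map_rel hab⟩,
      fun a b hab => hg
        (congrArg (fun x : ((closedNbhd (G.induce Yᶜ) D)ᶜ : Set _) => x.1.1) hab)⟩

/-- Let `G` be a graph, `𝓕 = {C_n : n ∈ S}` a set of cycles, and `Y ⊆ V(G)`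
such that `G[Y]` contains no `𝓕`-graph and at most one edge of `G` joins each component of
`G − Y` to `Y`. Then `ι(G, 𝓕) ≤ ι(G − Y, 𝓕)` and every `𝓕`-isolating set of `G − Y` is an
`𝓕`-isolating set of `G`. -/
theorem isolation_le_of_extension {V : Type*} [Fintype V] (G : SimpleGraph V)
    (S : Set ℕ) (hS : ∀ n ∈ S, 3 ≤ n) (Y : Set V)
    (hY : ∀ n ∈ S, ¬ HasCopy (cycleGraph n) (G.induce Y))
    (hcomp : ∀ H : (G.induce Yᶜ).ConnectedComponent,
      (edgesBetween G (Subtype.val '' H.supp) Y).ncard ≤ 1) :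
    iotaCycSet S G ≤ iotaCycSet S (G.induce Yᶜ) ∧
      ∀ D : Set ↥(Yᶜ), IsCycSetIsolating S (G.induce Yᶜ) D →
        IsCycSetIsolating S G (Subtype.val '' D) := by
  have hmain : ∀ D : Set ↥(Yᶜ), IsCycSetIsolating S (G.induce Yᶜ) D →
      IsCycSetIsolating S G (Subtype.val '' D) :=
    fun D hD => hD.of_induce_compl hS hY hcomp
  refine ⟨?_, hmain⟩
  have hne : {r | ∃ D : Set ↥(Yᶜ), D.ncard = r ∧
      IsCycSetIsolating S (G.induce Yᶜ) D}.Nonempty := by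
    refine ⟨_, Set.univ, rfl, ?_⟩
    rintro n hn ⟨f, -⟩
    exact (f ⟨0, by have := hS n hn; omega⟩).2 (Or.inl trivial)
  obtain ⟨D, hD, hiso⟩ := Nat.sInf_mem hne
  refine Nat.sInf_le ⟨Subtype.val '' D, ?_, hmain D hiso⟩
  rw [Set.ncard_image_of_injective _ Subtype.val_injective, hD, iotaCycSet]
end
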